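/- arXiv:1501.05263 — 3 statements merged into one kernel-verified Lean document; each statement's English description precedes it below -/
import Mathlib

section
/- Fix 0<c<∞, an integer d≥3, and an integer k≥1. There exist N and C (depending only on c, k, d) such that for all n>N, the log-Sobolev constant α_{n,k} of the trace chain Q_{n,k} of the KCIP on Ω_k satisfies α_{n,k} ≥ C·(1/n)·α^SE_{n,k}, where α^SE_{n,k} is the log-Sobolev constant of the simple exclusion process on Λ(L,d) with k particles. -/
open scoped Classical
open Finset

noncomputable section

/-- The number of particles (vertices labelled `1`) of a configuration. -/
def numParticles {V : Type*} [Fintype V] (x : V → Bool) : ℕ :=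
  (Finset.univ.filter fun v => x v = true).card

/-- One-step transition kernel of the kinetically constrained Ising process (KCIP)
on the graph `G` with density parameter `p`: a uniformly chosen vertex `v` is updated,
and its label is resampled (to `1` with probability `p`, to `0` otherwise) iff `v` has at
least one neighbour labelled `1`. -/
def kcipKernel {V : Type*} [Fintype V] (G : SimpleGraph V) (p : ℝ) (x y : V → Bool) : ℝ :=
  ((Fintype.card V : ℝ))⁻¹ * ∑ v : V,
    (if ∀ w, w ≠ v → y w = x w then
      (if ∃ u, G.Adj u v ∧ x u = true then (if y v = true then p else 1 - p)
       else (if y v = x v then 1 else 0))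
     else 0)

/-- Probability that the Markov chain with kernel `K` started at `x` produces a
trajectory `(X_0, …, X_T)` lying in the event `A`. -/
def trajProb {Ω : Type*} [Fintype Ω] (K : Ω → Ω → ℝ) (x : Ω) (T : ℕ)
    (A : (Fin (T + 1) → Ω) → Prop) : ℝ :=
  ∑ ω : Fin (T + 1) → Ω,
    if ω 0 = x ∧ A ω then ∏ i : Fin T, K (ω i.castSucc) (ω i.succ) else 0

/-- Expectation of a functional `f` of the trajectory `(X_0, …, X_T)` of the Markov chain
with kernel `K` started at `x`. -/
def trajExp {Ω : Type*} [Fintype Ω] (K : Ω → Ω → ℝ) (x : Ω) (T : ℕ)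
    (f : (Fin (T + 1) → Ω) → ℝ) : ℝ :=
  ∑ ω : Fin (T + 1) → Ω,
    (if ω 0 = x then ∏ i : Fin T, K (ω i.castSucc) (ω i.succ) else 0) * f ω

/-- The `d`-dimensional discrete torus `Z_L^d`: vertices are `Fin d → ZMod L`, with an edge
between `u` and `v` iff `u - v = ± e_i` for some coordinate vector `e_i`. -/
def torusGraph (L d : ℕ) : SimpleGraph (Fin d → ZMod L) :=
  SimpleGraph.fromRel fun u v => ∃ i : Fin d, v = u + fun j => if j = i then (1 : ZMod L) else 0

/-- `Ω_k`: configurations with exactly `k` particles, no two of which are adjacent. -/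
def OmegaK {V : Type*} [Fintype V] (G : SimpleGraph V) (k : ℕ) : Set (V → Bool) :=
  {x | numParticles x = k ∧ ∀ u v, G.Adj u v → ¬(x u = true ∧ x v = true)}

/-- Transition kernel of the trace of the KCIP on `Ω_k`: the probability that the first
visit of the chain to `Ω_k` after time `0` occurs at state `y`. -/
def traceKernel {V : Type*} [Fintype V] (G : SimpleGraph V) (p : ℝ) (k : ℕ)
    (x y : OmegaK G k) : ℝ :=
  ∑' t : ℕ, trajProb (kcipKernel G p) x.val (t + 1)
    (fun ω => ω (Fin.last (t + 1)) = y.val ∧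
      ∀ s : Fin (t + 2), s ≠ 0 → s ≠ Fin.last (t + 1) → ω s ∉ OmegaK G k)

/-- The uniform distribution on a finite type. -/
def unifDist (Ω : Type*) [Fintype Ω] : Ω → ℝ := fun _ => ((Fintype.card Ω : ℝ))⁻¹

/-- Dirichlet form `E_P(f,f) = (1/2) Σ_{x,y} |f(x)-f(y)|² P(x,y) μ(x)`. -/
def dirichletForm {Ω : Type*} [Fintype Ω] (K : Ω → Ω → ℝ) (μ : Ω → ℝ) (f : Ω → ℝ) : ℝ :=
  (1 / 2) * ∑ x : Ω, ∑ y : Ω, |f x - f y| ^ 2 * K x y * μ x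

/-- Entropy form `L_μ(f) = Σ_x f(x)² log(f(x)²/‖f‖²_{2,μ}) μ(x)`. -/
def entropyForm {Ω : Type*} [Fintype Ω] (μ : Ω → ℝ) (f : Ω → ℝ) : ℝ :=
  ∑ x : Ω, f x ^ 2 * Real.log (f x ^ 2 / (∑ y : Ω, f y ^ 2 * μ y)) * μ x

/-- Log-Sobolev constant `α(P) = inf_f E_P(f,f)/L_μ(f)`, the infimum running over functions
with nonvanishing entropy form. -/
def logSobolevConst {Ω : Type*} [Fintype Ω] (K : Ω → Ω → ℝ) (μ : Ω → ℝ) : ℝ :=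
  sInf {r : ℝ | ∃ f : Ω → ℝ, entropyForm μ f ≠ 0 ∧ r = dirichletForm K μ f / entropyForm μ f}

/-- Simple exclusion kernel on configurations: pick a uniformly random (ordered) pair of
adjacent vertices and swap their labels. -/
def seKernelFull {V : Type*} [Fintype V] [DecidableEq V] (G : SimpleGraph V)
    (x y : V → Bool) : ℝ :=
  (∑ u : V, ∑ v : V,
      if G.Adj u v ∧ y = Function.update (Function.update x u (x v)) v (x u) then (1 : ℝ)
      else 0) /
  (∑ u : V, ∑ v : V, if G.Adj u v then (1 : ℝ) else 0)

/-- The simple exclusion process with `k` particles on `G`, as a kernel on the set of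
configurations with exactly `k` particles. -/
def seKernel {V : Type*} [Fintype V] [DecidableEq V] (G : SimpleGraph V) (k : ℕ)
    (x y : {z : V → Bool // numParticles z = k}) : ℝ :=
  seKernelFull G x.val y.val

/-- The relative-entropy integrand is nonnegative. -/
lemma mul_log_div_sub_add_nonneg {a m : ℝ} (ha : 0 ≤ a) (hm : 0 < m) :
    0 ≤ a * Real.log (a / m) - a + m := by
  rcases ha.eq_or_lt with rfl | ha
  · simpa using hm.le
  · have h1 : Real.log (m / a) ≤ m / a - 1 := Real.log_le_sub_one_of_pos (by positivity)
    have h2 : Real.log (a / m) = -Real.log (m / a) := by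
      rw [← Real.log_inv, inv_div]
    have h3 : a * Real.log (m / a) ≤ a * (m / a - 1) := mul_le_mul_of_nonneg_left h1 ha.le
    have h4 : a * (m / a - 1) = m - a := by field_simp
    rw [h2]; linarith

lemma card_mul_entropyForm {Ω : Type*} [Fintype Ω] [Nonempty Ω] (f : Ω → ℝ) :
    (Fintype.card Ω : ℝ) * entropyForm (unifDist Ω) f =
      ∑ x, f x ^ 2 * Real.log (f x ^ 2 / (∑ y : Ω, f y ^ 2 * (Fintype.card Ω : ℝ)⁻¹)) := by
  have : (Fintype.card Ω : ℝ) ≠ 0 := by simp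
  unfold entropyForm unifDist
  rw [← Finset.sum_mul, mul_comm, mul_assoc, inv_mul_cancel₀ this, mul_one]

/-- Variational upper bound for the entropy form. -/
lemma card_mul_entropyForm_le {Ω : Type*} [Fintype Ω] [Nonempty Ω] (f : Ω → ℝ) {m : ℝ}
    (hm : 0 < m) :
    (Fintype.card Ω : ℝ) * entropyForm (unifDist Ω) f ≤
      ∑ x, (f x ^ 2 * Real.log (f x ^ 2 / m) - f x ^ 2 + m) := by
  rw [card_mul_entropyForm]
  set N : ℝ := (Fintype.card Ω : ℝ) with hN
  have hNpos : 0 < N := by simp [hN, Fintype.card_pos]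
  set m₀ := ∑ y : Ω, f y ^ 2 * N⁻¹ with hm₀
  have hm₀' : N * m₀ = ∑ y, f y ^ 2 := by
    rw [hm₀, ← Finset.sum_mul]; field_simp
  have hm₀n : 0 ≤ m₀ := Finset.sum_nonneg fun _ _ => by positivity
  have hsum : ∑ x, (f x ^ 2 * Real.log (f x ^ 2 / m) - f x ^ 2 + m)
      = ∑ x, f x ^ 2 * Real.log (f x ^ 2 / m) - N * m₀ + N * m := by
    rw [Finset.sum_add_distrib, Finset.sum_sub_distrib, hm₀']
    simp [hN]
  rw [hsum]
  have hterm : ∀ x, f x ^ 2 * Real.log (f x ^ 2 / m₀)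
      = f x ^ 2 * Real.log (f x ^ 2 / m) - f x ^ 2 * Real.log (m₀ / m) := by
    intro x
    by_cases hx : f x = 0
    · simp [hx]
    · have hx2 : 0 < f x ^ 2 := by positivity
      have hm₀pos : 0 < m₀ := by
        have h1 : f x ^ 2 ≤ ∑ y, f y ^ 2 :=
          Finset.single_le_sum (f := fun y => f y ^ 2) (fun _ _ => sq_nonneg _)
            (Finset.mem_univ x)
        by_contra h
        have : m₀ = 0 := le_antisymm (not_lt.mp h) hm₀n
        rw [this, mul_zero] at hm₀'
        linarith
      rw [Real.log_div hx2.ne' hm₀pos.ne', Real.log_div hx2.ne' hm.ne',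
        Real.log_div hm₀pos.ne' hm.ne']
      ring
  rw [Finset.sum_congr rfl fun x _ => hterm x, Finset.sum_sub_distrib, ← Finset.sum_mul, ← hm₀']
  have := mul_nonneg hNpos.le (mul_log_div_sub_add_nonneg hm₀n hm)
  linarith

/-- The entropy form with respect to the uniform distribution, without normalization, is
monotone under restriction of the function to a smaller set. -/
lemma card_mul_entropyForm_mono {Ω Ω' : Type*} [Fintype Ω] [Fintype Ω'] [Nonempty Ω]
    (e : Ω ↪ Ω') (f : Ω → ℝ) (g : Ω' → ℝ) (hfg : ∀ x, g (e x) = f x) :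
    (Fintype.card Ω : ℝ) * entropyForm (unifDist Ω) f ≤
      (Fintype.card Ω' : ℝ) * entropyForm (unifDist Ω') g := by
  have : Nonempty Ω' := ⟨e (Classical.arbitrary Ω)⟩
  set N : ℝ := (Fintype.card Ω' : ℝ) with hN
  have hNpos : 0 < N := by simp [hN, Fintype.card_pos]
  set m := ∑ y : Ω', g y ^ 2 * N⁻¹ with hm
  have hmN : N * m = ∑ y, g y ^ 2 := by
    rw [hm, ← Finset.sum_mul]; field_simp
  rcases (show 0 ≤ m from Finset.sum_nonneg fun y _ => by positivity).eq_or_lt with h0 | hpos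
  · have hg : ∀ y, g y = 0 := by
      intro y
      rw [← h0, mul_zero] at hmN
      have := (Finset.sum_eq_zero_iff_of_nonneg (fun y _ => sq_nonneg (g y))).mp hmN.symm y
        (Finset.mem_univ y)
      simpa using this
    have hf : ∀ x, f x = 0 := fun x => by rw [← hfg, hg]
    simp [entropyForm, hf, hg]
  · have hg : N * entropyForm (unifDist Ω') g =
        ∑ y, (g y ^ 2 * Real.log (g y ^ 2 / m) - g y ^ 2 + m) := by
      rw [Finset.sum_add_distrib, Finset.sum_sub_distrib, ← hmN, card_mul_entropyForm]
      simp [hN, hm]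
    rw [hg]
    refine (card_mul_entropyForm_le f hpos).trans ?_
    have : ∑ x, (f x ^ 2 * Real.log (f x ^ 2 / m) - f x ^ 2 + m) =
        ∑ y ∈ Finset.univ.map e, (g y ^ 2 * Real.log (g y ^ 2 / m) - g y ^ 2 + m) := by
      simp [Finset.sum_map, hfg]
    rw [this]
    exact Finset.sum_le_sum_of_subset_of_nonneg (Finset.subset_univ _)
      fun y _ _ => mul_log_div_sub_add_nonneg (sq_nonneg _) hpos

lemma entropyForm_unifDist_nonneg {Ω : Type*} [Fintype Ω] (f : Ω → ℝ) :
    0 ≤ entropyForm (unifDist Ω) f := by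
  cases isEmpty_or_nonempty Ω with
  | inl h => simp [entropyForm]
  | inr h =>
    have x : Ω := Classical.arbitrary Ω
    have h1 := card_mul_entropyForm_mono
      (⟨fun _ : Unit => x, fun _ _ _ => rfl⟩ : Unit ↪ Ω) (fun _ => f x) f (fun _ => rfl)
    have h2 : entropyForm (unifDist Unit) (fun _ => f x) = 0 := by
      by_cases hx : f x = 0 <;> simp [entropyForm, unifDist, hx]
    rw [h2, mul_zero] at h1
    have : (0 : ℝ) < Fintype.card Ω := by simp [Fintype.card_pos]
    exact nonneg_of_mul_nonneg_right h1 this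

/-- On a space with at least two points, some function has nonvanishing entropy form. -/
lemma exists_entropyForm_ne_zero {Ω : Type*} [Fintype Ω] [Nontrivial Ω] :
    ∃ f : Ω → ℝ, entropyForm (unifDist Ω) f ≠ 0 := by
  obtain ⟨a⟩ : Nonempty Ω := inferInstance
  refine ⟨fun x => if x = a then 1 else 0, ?_⟩
  have h1 : (1 : ℝ) < Fintype.card Ω := by exact_mod_cast Fintype.one_lt_card
  intro h
  have h2 := card_mul_entropyForm (fun x : Ω => if x = a then (1 : ℝ) else 0)
  rw [h, mul_zero] at h2
  have h3 := Real.log_pos h1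
  simp [ite_pow] at h2
  linarith

lemma dirichletForm_nonneg {Ω : Type*} [Fintype Ω] {K : Ω → Ω → ℝ} {μ : Ω → ℝ} (f : Ω → ℝ)
    (hK : ∀ x y, 0 ≤ K x y) (hμ : ∀ x, 0 ≤ μ x) : 0 ≤ dirichletForm K μ f := by
  unfold dirichletForm
  refine mul_nonneg (by norm_num) (Finset.sum_nonneg fun x _ => Finset.sum_nonneg fun y _ => ?_)
  exact mul_nonneg (mul_nonneg (by positivity) (hK x y)) (hμ x)

lemma logSobolevConst_nonneg {Ω : Type*} [Fintype Ω] {K : Ω → Ω → ℝ}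
    (hK : ∀ x y, 0 ≤ K x y) : 0 ≤ logSobolevConst K (unifDist Ω) := by
  refine Real.sInf_nonneg ?_
  rintro r ⟨f, -, rfl⟩
  exact div_nonneg (dirichletForm_nonneg f hK fun x => by unfold unifDist; positivity)
    (entropyForm_unifDist_nonneg f)

lemma logSobolevConst_mul_entropyForm_le {Ω : Type*} [Fintype Ω] {K : Ω → Ω → ℝ}
    (hK : ∀ x y, 0 ≤ K x y) (f : Ω → ℝ) :
    logSobolevConst K (unifDist Ω) * entropyForm (unifDist Ω) f ≤
      dirichletForm K (unifDist Ω) f := by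
  have hμ : ∀ x, 0 ≤ unifDist Ω x := fun x => by unfold unifDist; positivity
  have hE := dirichletForm_nonneg f hK hμ
  rcases (entropyForm_unifDist_nonneg f).eq_or_lt with h | h
  · rw [← h, mul_zero]; exact hE
  · rw [← le_div_iff₀ h]
    refine csInf_le ⟨0, ?_⟩ ⟨f, h.ne', rfl⟩
    rintro r ⟨g, -, rfl⟩
    exact div_nonneg (dirichletForm_nonneg g hK hμ) (entropyForm_unifDist_nonneg g)

/-- Comparison of log-Sobolev constants: it suffices to extend every function on the small
space to the large one with control of the (unnormalized) Dirichlet forms. -/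
lemma logSobolevConst_comparison {Ω Ω' : Type*} [Fintype Ω] [Fintype Ω'] [Nontrivial Ω]
    (e : Ω ↪ Ω') {K : Ω → Ω → ℝ} {K' : Ω' → Ω' → ℝ} (hK' : ∀ x y, 0 ≤ K' x y) {A : ℝ}
    (hA : 0 ≤ A)
    (hext : ∀ f : Ω → ℝ, ∃ g : Ω' → ℝ, (∀ x, g (e x) = f x) ∧
      A * ∑ x, ∑ y, |g x - g y| ^ 2 * K' x y ≤ ∑ x, ∑ y, |f x - f y| ^ 2 * K x y) :
    A * logSobolevConst K' (unifDist Ω') ≤ logSobolevConst K (unifDist Ω) := by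
  refine le_csInf ?_ ?_
  · obtain ⟨f, hf⟩ := exists_entropyForm_ne_zero (Ω := Ω)
    exact ⟨_, f, hf, rfl⟩
  · rintro r ⟨f, hf, rfl⟩
    have hpos : 0 < entropyForm (unifDist Ω) f :=
      lt_of_le_of_ne (entropyForm_unifDist_nonneg f) hf.symm
    rw [le_div_iff₀ hpos]
    obtain ⟨g, hg, hgE⟩ := hext f
    have hN : (0 : ℝ) < Fintype.card Ω := by simp [Fintype.card_pos]
    have : Nonempty Ω' := ⟨e (Classical.arbitrary Ω)⟩
    have hN' : (0 : ℝ) < Fintype.card Ω' := by simp [Fintype.card_pos]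
    have h1 := card_mul_entropyForm_mono e f g hg
    have h2 := logSobolevConst_mul_entropyForm_le hK' g
    have h3 := logSobolevConst_nonneg hK'
    have e1 : (Fintype.card Ω : ℝ) * dirichletForm K (unifDist Ω) f =
        1 / 2 * ∑ x, ∑ y, |f x - f y| ^ 2 * K x y := by
      simp only [dirichletForm, unifDist, ← Finset.sum_mul]; field_simp
    have e2 : (Fintype.card Ω' : ℝ) * dirichletForm K' (unifDist Ω') g =
        1 / 2 * ∑ x, ∑ y, |g x - g y| ^ 2 * K' x y := by
      simp only [dirichletForm, unifDist, ← Finset.sum_mul]; field_simp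
    refine le_of_mul_le_mul_left ?_ hN
    calc (Fintype.card Ω : ℝ) *
          (A * logSobolevConst K' (unifDist Ω') * entropyForm (unifDist Ω) f)
        = A * logSobolevConst K' (unifDist Ω') *
          (Fintype.card Ω * entropyForm (unifDist Ω) f) := by ring
      _ ≤ A * logSobolevConst K' (unifDist Ω') *
          (Fintype.card Ω' * entropyForm (unifDist Ω') g) :=
          mul_le_mul_of_nonneg_left h1 (mul_nonneg hA h3)
      _ = A * (Fintype.card Ω' *
          (logSobolevConst K' (unifDist Ω') * entropyForm (unifDist Ω') g)) := by ring
      _ ≤ A * (Fintype.card Ω' * dirichletForm K' (unifDist Ω') g) := by gcongr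
      _ ≤ Fintype.card Ω * dirichletForm K (unifDist Ω) f := by
          rw [e1, e2]; linarith


/-- Probability that the chain with kernel `K` started at `x` first visits the target set `B`
after time `0` at time `t + 1`, in the state `y`. -/
def firstHit {Ω : Type*} [Fintype Ω] (K : Ω → Ω → ℝ) (B : Set Ω) (y : Ω) : ℕ → Ω → ℝ
  | 0, x => K x y
  | t + 1, x => ∑ z, if z ∈ B then 0 else K x z * firstHit K B y t z

lemma sum_fin_cons {Ω : Type*} [Fintype Ω] {T : ℕ} (F : (Fin (T + 1) → Ω) → ℝ) :
    ∑ ω, F ω = ∑ a : Ω, ∑ ω : Fin T → Ω, F (Fin.cons a ω) := by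
  rw [← (Fin.consEquiv fun _ : Fin (T + 1) => Ω).sum_comp, Fintype.sum_prod_type]
  rfl

lemma trajProb_zero {Ω : Type*} [Fintype Ω] (K : Ω → Ω → ℝ) (x : Ω)
    (A : (Fin 1 → Ω) → Prop) :
    trajProb K x 0 A = if A (fun _ => x) then 1 else 0 := by
  unfold trajProb
  rw [Finset.sum_eq_single (fun _ => x)]
  · simp
  · intro ω _ hω
    rw [if_neg]
    rintro ⟨h, -⟩
    exact hω (funext fun i => by rw [← h]; congr 1; exact Subsingleton.elim (α := Fin 1) i 0)
  · simp

/-- First-step decomposition of trajectory probabilities. -/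
lemma trajProb_succ {Ω : Type*} [Fintype Ω] (K : Ω → Ω → ℝ) (x : Ω) (T : ℕ)
    (A : (Fin (T + 2) → Ω) → Prop) :
    trajProb K x (T + 1) A =
      ∑ z, K x z * trajProb K z T (fun ω => A (Fin.cons x ω)) := by
  unfold trajProb
  rw [sum_fin_cons]
  rw [Finset.sum_eq_single x]
  · simp only [Finset.mul_sum]
    rw [Finset.sum_comm]
    refine Finset.sum_congr rfl fun ω _ => ?_
    rw [Finset.sum_eq_single (ω 0)]
    · by_cases hA : A (Fin.cons x ω)
      · rw [if_pos ⟨by simp, hA⟩, if_pos ⟨rfl, hA⟩, Fin.prod_univ_succ]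
        simp
      · rw [if_neg (fun h => hA h.2), if_neg (fun h => hA h.2), mul_zero]
    · intro z _ hz
      rw [if_neg (fun h => hz h.1.symm), mul_zero]
    · simp
  · intro a _ ha
    refine Finset.sum_eq_zero fun ω _ => ?_
    rw [if_neg]
    rintro ⟨h, -⟩
    exact ha (by simpa using h)
  · simp

lemma trajProb_congr {Ω : Type*} [Fintype Ω] (K : Ω → Ω → ℝ) (x : Ω) (T : ℕ)
    {A A' : (Fin (T + 1) → Ω) → Prop} (h : ∀ ω, ω 0 = x → (A ω ↔ A' ω)) :
    trajProb K x T A = trajProb K x T A' := by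
  unfold trajProb
  refine Finset.sum_congr rfl fun ω _ => ?_
  by_cases h0 : ω 0 = x
  · simp [h0, h ω h0]
  · simp [h0]

lemma trajProb_false {Ω : Type*} [Fintype Ω] (K : Ω → Ω → ℝ) (x : Ω) (T : ℕ) :
    trajProb K x T (fun _ => False) = 0 := by
  simp [trajProb]

lemma trajProb_eq_firstHit {Ω : Type*} [Fintype Ω] (K : Ω → Ω → ℝ) (B : Set Ω) (y : Ω)
    (t : ℕ) (x : Ω) :
    trajProb K x (t + 1) (fun ω => ω (Fin.last (t + 1)) = y ∧
      ∀ s : Fin (t + 2), s ≠ 0 → s ≠ Fin.last (t + 1) → ω s ∉ B) = firstHit K B y t x := by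
  induction t generalizing x with
  | zero =>
    rw [trajProb_succ]
    simp only [trajProb_zero, firstHit]
    rw [Finset.sum_eq_single y]
    · rw [if_pos, mul_one]
      refine ⟨rfl, fun s h0 h1 => ?_⟩
      fin_cases s <;> simp at h0 h1
    · intro z _ hz
      rw [if_neg, mul_zero]
      rintro ⟨h, -⟩
      exact hz h
    · simp
  | succ t ih =>
    rw [trajProb_succ]
    simp only [firstHit]
    refine Finset.sum_congr rfl fun z _ => ?_
    by_cases hz : z ∈ B
    · rw [if_pos hz, trajProb_congr (A' := fun _ => False), trajProb_false, mul_zero]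
      intro ω hω
      simp only [iff_false, not_and, not_forall]
      intro _
      refine ⟨Fin.succ 0, Fin.succ_ne_zero _, ?_, ?_⟩
      · rw [← Fin.succ_last]
        intro h
        have := Fin.succ_injective _ h
        exact absurd (congrArg Fin.val this) (by simp)
      · rw [Fin.cons_succ, hω]
        exact not_not.mpr hz
    · rw [if_neg hz, ← ih z]
      congr 1
      refine trajProb_congr K z (t + 1) fun ω hω => ?_
      rw [← Fin.succ_last, Fin.cons_succ]
      refine and_congr_right fun _ => ⟨fun h s _ hs => ?_, fun h s h0 hs => ?_⟩
      · have := h s.succ (Fin.succ_ne_zero _) (fun e => hs (Fin.succ_injective _ e))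
        rwa [Fin.cons_succ] at this
      · obtain ⟨s', rfl⟩ := Fin.exists_succ_eq.mpr h0
        rw [Fin.cons_succ]
        by_cases hs' : s' = 0
        · rw [hs', hω]; exact hz
        · exact h s' hs' (fun e => hs (by rw [e]))

lemma firstHit_nonneg {Ω : Type*} [Fintype Ω] {K : Ω → Ω → ℝ} (hK : ∀ x y, 0 ≤ K x y)
    (B : Set Ω) (y : Ω) (t : ℕ) (x : Ω) : 0 ≤ firstHit K B y t x := by
  induction t generalizing x with
  | zero => exact hK x y
  | succ t ih =>
    refine Finset.sum_nonneg fun z _ => ?_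
    split_ifs
    · exact le_rfl
    · exact mul_nonneg (hK x z) (ih z)

lemma sum_firstHit_succ {Ω : Type*} [Fintype Ω] (K : Ω → Ω → ℝ) (B : Set Ω) (y : Ω)
    (T : ℕ) (x : Ω) :
    ∑ t ∈ Finset.range (T + 1), firstHit K B y t x =
      K x y + ∑ z, if z ∈ B then 0 else K x z * ∑ t ∈ Finset.range T, firstHit K B y t z := by
  rw [Finset.sum_range_succ', add_comm]
  simp only [firstHit]
  rw [Finset.sum_comm]
  congr 1
  refine Finset.sum_congr rfl fun z _ => ?_
  split_ifs
  · simp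
  · rw [Finset.mul_sum]

lemma sum_firstHit_le_one {Ω : Type*} [Fintype Ω] {K : Ω → Ω → ℝ} (hK : ∀ x y, 0 ≤ K x y)
    (hK1 : ∀ x, ∑ y, K x y ≤ 1) {B : Set Ω} {y : Ω} (hy : y ∈ B) (T : ℕ) (x : Ω) :
    ∑ t ∈ Finset.range T, firstHit K B y t x ≤ 1 := by
  induction T generalizing x with
  | zero => simp
  | succ T ih =>
    rw [sum_firstHit_succ]
    refine le_trans ?_ (hK1 x)
    rw [← Finset.add_sum_erase _ _ (Finset.mem_univ y),
      ← Finset.add_sum_erase _ (fun z => K x z) (Finset.mem_univ y), if_pos hy, zero_add]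
    gcongr with z _
    split_ifs
    · exact hK x z
    · exact mul_le_of_le_one_right (hK x z) (ih z)

lemma summable_firstHit {Ω : Type*} [Fintype Ω] {K : Ω → Ω → ℝ} (hK : ∀ x y, 0 ≤ K x y)
    (hK1 : ∀ x, ∑ y, K x y ≤ 1) {B : Set Ω} {y : Ω} (hy : y ∈ B) (x : Ω) :
    Summable fun t => firstHit K B y t x :=
  summable_of_sum_range_le (fun t => firstHit_nonneg hK B y t x)
    fun T => sum_firstHit_le_one hK hK1 hy T x

/-- First-step equation for the total hitting probability. -/
lemma tsum_firstHit {Ω : Type*} [Fintype Ω] {K : Ω → Ω → ℝ} (hK : ∀ x y, 0 ≤ K x y)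
    (hK1 : ∀ x, ∑ y, K x y ≤ 1) {B : Set Ω} {y : Ω} (hy : y ∈ B) (x : Ω) :
    ∑' t, firstHit K B y t x =
      K x y + ∑ z, if z ∈ B then 0 else K x z * ∑' t, firstHit K B y t z := by
  rw [(summable_firstHit hK hK1 hy x).tsum_eq_zero_add]
  simp only [firstHit]
  congr 1
  rw [Summable.tsum_finsetSum]
  · refine Finset.sum_congr rfl fun z _ => ?_
    split_ifs
    · simp
    · rw [tsum_mul_left]
  · intro z _
    split_ifs
    · exact summable_zero
    · exact (summable_firstHit hK hK1 hy z).mul_left _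

/-- A lower bound for the hitting distribution coming from an excursion through a single
intermediate state `z`, which the chain leaves slowly. -/
lemma le_tsum_firstHit {Ω : Type*} [Fintype Ω] {K : Ω → Ω → ℝ} (hK : ∀ x y, 0 ≤ K x y)
    (hK1 : ∀ x, ∑ y, K x y ≤ 1) {B : Set Ω} {y : Ω} (hy : y ∈ B) (x z : Ω) (hz : z ∉ B) {δ : ℝ}
    (hδ : 0 < δ) (hzz : 1 - δ ≤ K z z) :
    K x z * (K z y / δ) ≤ ∑' t, firstHit K B y t x := by
  have hG : ∀ w, 0 ≤ ∑' t, firstHit K B y t w :=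
    fun w => tsum_nonneg fun t => firstHit_nonneg hK B y t w
  have key : ∀ w, K w y + K w z * ∑' t, firstHit K B y t z ≤ ∑' t, firstHit K B y t w := by
    intro w
    rw [tsum_firstHit hK hK1 hy w]
    gcongr
    have h : ∀ v ∈ (Finset.univ : Finset Ω),
        0 ≤ if v ∈ B then 0 else K w v * ∑' t, firstHit K B y t v := by
      intro v _
      split_ifs
      · exact le_rfl
      · exact mul_nonneg (hK _ _) (hG _)
    have := Finset.single_le_sum h (Finset.mem_univ z)
    rwa [if_neg hz] at this
  have h1 := key z
  have h2 : K z y / δ ≤ ∑' t, firstHit K B y t z := by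
    rw [div_le_iff₀ hδ]
    have := mul_le_mul_of_nonneg_right hzz (hG z)
    linarith
  have h3 := key x
  have h4 := mul_le_mul_of_nonneg_left h2 (hK x z)
  have := hK x y
  linarith

lemma kcipKernel_nonneg {V : Type*} [Fintype V] (G : SimpleGraph V) {p : ℝ} (hp0 : 0 ≤ p)
    (hp1 : p ≤ 1) (x y : V → Bool) : 0 ≤ kcipKernel G p x y := by
  unfold kcipKernel
  refine mul_nonneg (by positivity) (Finset.sum_nonneg fun v _ => ?_)
  split_ifs <;> linarith

lemma sum_kcipKernel_le_one {V : Type*} [Fintype V] (G : SimpleGraph V) (p : ℝ)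
    (x : V → Bool) : ∑ y, kcipKernel G p x y ≤ 1 := by
  unfold kcipKernel
  rw [← Finset.mul_sum, Finset.sum_comm]
  have h : ∀ v : V, ∑ y : V → Bool, (if ∀ w, w ≠ v → y w = x w then
      (if ∃ u, G.Adj u v ∧ x u = true then (if y v = true then p else 1 - p)
       else (if y v = x v then 1 else 0)) else 0) = 1 := by
    intro v
    have h1 : (Finset.univ.filter fun y : V → Bool => ∀ w, w ≠ v → y w = x w) =
        {Function.update x v true, Function.update x v false} := by
      ext y
      simp only [Finset.mem_filter, Finset.mem_univ, true_and, Finset.mem_insert,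
        Finset.mem_singleton]
      constructor
      · intro h
        cases hy : y v
        · right; rw [Function.eq_update_iff]; exact ⟨hy, h⟩
        · left; rw [Function.eq_update_iff]; exact ⟨hy, h⟩
      · rintro (rfl | rfl) w hw <;> simp [hw]
    have h2 : Function.update x v true ≠ Function.update x v false := by
      intro h
      simpa using congrFun h v
    rw [← Finset.sum_filter, h1, Finset.sum_pair h2]
    by_cases hv : ∃ u, G.Adj u v ∧ x u = true
    · simp [hv]
    · simp only [if_neg hv, Function.update_self]
      cases x v <;> simp
  rw [Finset.sum_congr rfl fun v _ => h v]
  simp only [Finset.sum_const, Finset.card_univ, nsmul_eq_mul, mul_one]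
  exact inv_mul_le_one

lemma traceKernel_eq_tsum {V : Type*} [Fintype V] (G : SimpleGraph V) (p : ℝ) (k : ℕ)
    (x y : OmegaK G k) :
    traceKernel G p k x y = ∑' t, firstHit (kcipKernel G p) (OmegaK G k) y.val t x.val := by
  unfold traceKernel
  exact tsum_congr fun t => trajProb_eq_firstHit _ _ _ _ _

lemma traceKernel_nonneg {V : Type*} [Fintype V] (G : SimpleGraph V) {p : ℝ} (hp0 : 0 ≤ p)
    (hp1 : p ≤ 1) (k : ℕ) (x y : OmegaK G k) : 0 ≤ traceKernel G p k x y := by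
  rw [traceKernel_eq_tsum]
  exact tsum_nonneg fun t => firstHit_nonneg (kcipKernel_nonneg G hp0 hp1) _ _ _ _

/-- A single vertex update has probability at least `1 / n` times its resampling weight. -/
lemma le_kcipKernel {V : Type*} [Fintype V] (G : SimpleGraph V) {p : ℝ} (hp0 : 0 ≤ p)
    (hp1 : p ≤ 1) (x : V → Bool) {u v : V} (huv : G.Adj u v) (hu : x u = true) (b : Bool) :
    (Fintype.card V : ℝ)⁻¹ * (if b = true then p else 1 - p) ≤
      kcipKernel G p x (Function.update x v b) := by
  unfold kcipKernel
  refine mul_le_mul_of_nonneg_left ?_ (by positivity)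
  have h : ∀ w ∈ (Finset.univ : Finset V), 0 ≤
      (if ∀ w', w' ≠ w → Function.update x v b w' = x w' then
      (if ∃ u, G.Adj u w ∧ x u = true then (if Function.update x v b w = true then p else 1 - p)
       else (if Function.update x v b w = x w then 1 else 0)) else 0) := by
    intro w _
    split_ifs <;> linarith
  refine le_trans (le_of_eq ?_) (Finset.single_le_sum h (Finset.mem_univ v))
  have hc : ∀ w, w ≠ v → Function.update x v b w = x w :=
    fun w hw => Function.update_of_ne hw _ _
  have hc' : ∃ u', G.Adj u' v ∧ x u' = true := ⟨u, huv, hu⟩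
  rw [if_pos hc, if_pos hc', Function.update_self]

/-- A configuration in which few vertices have an occupied neighbour is left slowly. -/
lemma one_sub_le_kcipKernel_self {V : Type*} [Fintype V] [Nonempty V] (G : SimpleGraph V)
    {p : ℝ} (hp0 : 0 ≤ p) (hp1 : p ≤ 1) (x : V → Bool) {Δ : ℕ}
    (hΔ : ∀ u, (Finset.univ.filter fun v => G.Adj u v).card ≤ Δ) :
    1 - (numParticles x * Δ : ℝ) / Fintype.card V ≤ kcipKernel G p x x := by
  unfold kcipKernel
  have hn : (0 : ℝ) < Fintype.card V := by simp [Fintype.card_pos]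
  have h1 : (1 - (numParticles x * Δ : ℝ) / Fintype.card V) =
      (Fintype.card V : ℝ)⁻¹ * (Fintype.card V - numParticles x * Δ) := by
    field_simp
  rw [h1]
  gcongr
  set W := (Finset.univ.filter fun v => ∃ u, G.Adj u v ∧ x u = true) with hW
  have hWc : W.card ≤ numParticles x * Δ := by
    have : W ⊆ (Finset.univ.filter fun v => x v = true).biUnion
        fun u => Finset.univ.filter fun v => G.Adj u v := by
      intro v hv
      simp only [hW, Finset.mem_filter, Finset.mem_univ, true_and] at hv
      obtain ⟨u, h1, h2⟩ := hv
      simp only [Finset.mem_biUnion, Finset.mem_filter, Finset.mem_univ, true_and]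
      exact ⟨u, h2, h1⟩
    exact (Finset.card_le_card this).trans (Finset.card_biUnion_le_card_mul _ _ _ fun u _ => hΔ u)
  have h2 : ∀ v ∈ (Finset.univ : Finset V), (1 - if v ∈ W then (1 : ℝ) else 0) ≤
      (if ∀ w, w ≠ v → x w = x w then
      (if ∃ u, G.Adj u v ∧ x u = true then (if x v = true then p else 1 - p)
       else (if x v = x v then 1 else 0)) else 0) := by
    intro v _
    rw [if_pos (fun _ _ => rfl)]
    by_cases hv : v ∈ W
    · rw [if_pos hv]
      split_ifs <;> linarith
    · rw [if_neg hv]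
      have : ¬ ∃ u, G.Adj u v ∧ x u = true := by simpa [hW] using hv
      rw [if_neg this, if_pos rfl, sub_zero]
  refine le_trans ?_ (Finset.sum_le_sum h2)
  rw [Finset.sum_sub_distrib]
  simp only [Finset.sum_const, Finset.card_univ, nsmul_eq_mul, mul_one, Finset.sum_boole,
    Finset.filter_mem_eq_inter, Finset.univ_inter]
  have : (W.card : ℝ) ≤ numParticles x * Δ := by exact_mod_cast hWc
  linarith

lemma numParticles_update_true {V : Type*} [Fintype V] (x : V → Bool) {w : V}
    (hw : x w = false) : numParticles (Function.update x w true) = numParticles x + 1 := by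
  unfold numParticles
  have : (Finset.univ.filter fun v => Function.update x w true v = true) =
      insert w (Finset.univ.filter fun v => x v = true) := by
    ext v
    by_cases hv : v = w
    · simp [hv]
    · simp [hv]
  rw [this, Finset.card_insert_of_notMem (by simp [hw])]

/-- The trace chain performs each admissible slide of a particle to a neighbouring vertex with
probability at least of order `p / n`. -/
lemma le_traceKernel_slide {V : Type*} [Fintype V] (G : SimpleGraph V) {p : ℝ} (hp0 : 0 ≤ p)
    (hp1 : p ≤ 1 / 2) (k : ℕ) {Δ : ℕ} (hΔ0 : 0 < Δ)
    (hΔ : ∀ u, (Finset.univ.filter fun v => G.Adj u v).card ≤ Δ) (x y : OmegaK G k)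
    {u w : V} (huw : G.Adj u w) (hu : x.val u = true) (hw : x.val w = false)
    (hy : y.val = Function.update (Function.update x.val w true) u false) :
    p / (Fintype.card V) * (1 / (2 * ((k + 1) * Δ))) ≤ traceKernel G p k x y := by
  have : Nonempty V := ⟨u⟩
  have hn : (0 : ℝ) < Fintype.card V := by simp [Fintype.card_pos]
  rw [traceKernel_eq_tsum]
  have hp1' : p ≤ 1 := by linarith
  set z := Function.update x.val w true with hz
  have hzk : numParticles z = k + 1 := by
    rw [hz, numParticles_update_true _ hw, x.2.1]
  have hzB : z ∉ OmegaK G k := by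
    intro h
    have := h.1
    omega
  have h1 : p / Fintype.card V ≤ kcipKernel G p x.val z := by
    have := le_kcipKernel G hp0 hp1' x.val huw hu true
    rwa [if_pos rfl, mul_comm, ← div_eq_mul_inv] at this
  have h2 : (Fintype.card V : ℝ)⁻¹ * (1 / 2) ≤ kcipKernel G p z y.val := by
    have := le_kcipKernel G hp0 hp1' z huw.symm (by simp [hz]) false
    rw [← hy] at this
    refine le_trans ?_ this
    gcongr
    simp
    linarith
  have h3 := one_sub_le_kcipKernel_self G hp0 hp1' z hΔ
  rw [hzk] at h3
  have hΔ' : (0 : ℝ) < Δ := by exact_mod_cast hΔ0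
  have hδ : (0 : ℝ) < ((k + 1 : ℕ) * Δ : ℝ) / Fintype.card V := by positivity
  refine le_trans ?_ (le_tsum_firstHit (kcipKernel_nonneg G hp0 hp1')
    (sum_kcipKernel_le_one G p) y.2 x.val z hzB hδ h3)
  have h4 : (1 / (2 * ((k + 1) * Δ)) : ℝ) ≤
      kcipKernel G p z y.val / (((k + 1 : ℕ) * Δ : ℝ) / Fintype.card V) := by
    rw [le_div_iff₀ hδ]
    refine le_trans (le_of_eq ?_) h2
    push_cast
    field_simp
  have h5 := kcipKernel_nonneg G hp0 hp1' x.val z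
  gcongr


section Torus

open scoped Pointwise

/-- The displacements `0` and `± e_a` with `a ∈ P` on the torus. -/
def stepSet (M : ℕ) {d : ℕ} (P : Finset (Fin d)) : Finset (Fin d → ZMod M) :=
  insert 0 (P.image (fun a => Pi.single a (1 : ZMod M)) ∪
    P.image (fun a => -Pi.single a (1 : ZMod M)))

section Steps

variable {M d : ℕ}

lemma mem_stepSet {P : Finset (Fin d)} {s : Fin d → ZMod M} :
    s ∈ stepSet M P ↔ s = 0 ∨ ∃ a ∈ P, s = Pi.single a 1 ∨ s = -Pi.single a 1 := by
  simp only [stepSet, Finset.mem_insert, Finset.mem_union, Finset.mem_image]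
  constructor
  · rintro (h | ⟨a, ha, rfl⟩ | ⟨a, ha, rfl⟩)
    · exact Or.inl h
    · exact Or.inr ⟨a, ha, Or.inl rfl⟩
    · exact Or.inr ⟨a, ha, Or.inr rfl⟩
  · rintro (h | ⟨a, ha, rfl | rfl⟩)
    · exact Or.inl h
    · exact Or.inr (Or.inl ⟨a, ha, rfl⟩)
    · exact Or.inr (Or.inr ⟨a, ha, rfl⟩)

lemma zero_mem_stepSet (P : Finset (Fin d)) : (0 : Fin d → ZMod M) ∈ stepSet M P :=
  Finset.mem_insert_self _ _

lemma stepSet_mono {P Q : Finset (Fin d)} (h : P ⊆ Q) : stepSet M P ⊆ stepSet M Q := by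
  intro s hs
  rw [mem_stepSet] at hs ⊢
  rcases hs with h0 | ⟨a, ha, hs⟩
  · exact Or.inl h0
  · exact Or.inr ⟨a, h ha, hs⟩

lemma card_stepSet_le (P : Finset (Fin d)) : (stepSet M P).card ≤ 2 * d + 1 := by
  unfold stepSet
  refine (Finset.card_insert_le _ _).trans ?_
  have h1 := Finset.card_union_le (P.image fun a => Pi.single a (1 : ZMod M))
    (P.image fun a => -Pi.single a (1 : ZMod M))
  have h2 := Finset.card_image_le (s := P) (f := fun a => Pi.single (M := fun _ => ZMod M) a 1)
  have h3 := Finset.card_image_le (s := P) (f := fun a => -Pi.single (M := fun _ => ZMod M) a 1)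
  have h4 : P.card ≤ d := by simpa using Finset.card_le_univ P
  omega

lemma neg_mem_stepSet {P : Finset (Fin d)} {s : Fin d → ZMod M} (h : s ∈ stepSet M P) :
    -s ∈ stepSet M P := by
  rw [mem_stepSet] at h ⊢
  rcases h with rfl | ⟨a, ha, rfl | rfl⟩
  · exact Or.inl neg_zero
  · exact Or.inr ⟨a, ha, Or.inr rfl⟩
  · exact Or.inr ⟨a, ha, Or.inl (neg_neg _)⟩

lemma nsmul_stepSet_mono {P Q : Finset (Fin d)} (h : P ⊆ Q) {m n : ℕ} (hmn : m ≤ n) :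
    m • stepSet M P ⊆ n • stepSet M Q :=
  (Finset.nsmul_subset_nsmul_right (zero_mem_stepSet P) hmn).trans
    (Finset.nsmul_subset_nsmul_left (stepSet_mono h))

lemma add_mem_nsmul_stepSet {P : Finset (Fin d)} {m n : ℕ} {s t : Fin d → ZMod M}
    (hs : s ∈ m • stepSet M P) (ht : t ∈ n • stepSet M P) : s + t ∈ (m + n) • stepSet M P := by
  rw [add_nsmul]
  exact Finset.add_mem_add hs ht

lemma neg_mem_nsmul_stepSet {P : Finset (Fin d)} {n : ℕ} {s : Fin d → ZMod M}
    (hs : s ∈ n • stepSet M P) : -s ∈ n • stepSet M P := by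
  induction n generalizing s with
  | zero => simp_all
  | succ n ih =>
    rw [succ_nsmul] at hs ⊢
    obtain ⟨u, hu, v, hv, rfl⟩ := Finset.mem_add.mp hs
    rw [neg_add]
    exact Finset.add_mem_add (ih hu) (neg_mem_stepSet hv)

lemma nsmul_single_mem {P : Finset (Fin d)} {a : Fin d} (ha : a ∈ P) (n : ℕ) :
    n • Pi.single a (1 : ZMod M) ∈ n • stepSet M P := by
  induction n with
  | zero => simp
  | succ n ih =>
    rw [succ_nsmul, succ_nsmul]
    exact Finset.add_mem_add ih (mem_stepSet.mpr (Or.inr ⟨a, ha, Or.inl rfl⟩))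

lemma apply_eq_zero_of_mem_stepSet {P : Finset (Fin d)} {b : Fin d} (hb : b ∉ P)
    {s : Fin d → ZMod M} (h : s ∈ stepSet M P) : s b = 0 := by
  rw [mem_stepSet] at h
  rcases h with rfl | ⟨a, ha, rfl | rfl⟩
  · rfl
  · exact Pi.single_eq_of_ne (fun e : b = a => hb (e ▸ ha)) _
  · rw [Pi.neg_apply, Pi.single_eq_of_ne (fun e : b = a => hb (e ▸ ha)), neg_zero]

lemma apply_eq_zero_of_mem_nsmul {P : Finset (Fin d)} {b : Fin d} (hb : b ∉ P) {n : ℕ}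
    {s : Fin d → ZMod M} (h : s ∈ n • stepSet M P) : s b = 0 := by
  induction n generalizing s with
  | zero => simp_all
  | succ n ih =>
    rw [succ_nsmul] at h
    obtain ⟨u, hu, v, hv, rfl⟩ := Finset.mem_add.mp h
    rw [Pi.add_apply, ih hu, apply_eq_zero_of_mem_stepSet hb hv, add_zero]

lemma torusGraph_adj {u v : Fin d → ZMod M} :
    (torusGraph M d).Adj u v ↔ u ≠ v ∧ v - u ∈ stepSet M Finset.univ := by
  have he : ∀ i : Fin d, (fun j => if j = i then (1 : ZMod M) else 0) = Pi.single i 1 := by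
    intro i; ext j; simp [Pi.single_apply]
  unfold torusGraph
  simp only [SimpleGraph.fromRel_adj, he, mem_stepSet, Finset.mem_univ, true_and]
  refine and_congr_right fun hne => ⟨?_, ?_⟩
  · rintro (⟨i, rfl⟩ | ⟨i, rfl⟩)
    · exact Or.inr ⟨i, Or.inl (by abel)⟩
    · exact Or.inr ⟨i, Or.inr (by abel)⟩
  · rintro (h | ⟨i, h | h⟩)
    · exact absurd (sub_eq_zero.mp h).symm hne
    · exact Or.inl ⟨i, by rw [← h]; abel⟩
    · exact Or.inr ⟨i, by rw [← neg_eq_iff_eq_neg] at h; rw [← h]; abel⟩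

lemma card_torusGraph_neighbors_le [NeZero M] (u : Fin d → ZMod M) :
    (Finset.univ.filter fun v => (torusGraph M d).Adj u v).card ≤ 2 * d + 1 := by
  refine le_trans ?_ (card_stepSet_le (M := M) (Finset.univ : Finset (Fin d)))
  refine Finset.card_le_card_of_injOn (fun v => v - u) ?_ ?_
  · intro v hv
    exact (torusGraph_adj.mp (Finset.mem_filter.mp hv).2).2
  · intro v _ w _ h
    exact sub_left_injective h

end Steps

/-- The configuration whose occupied vertices are the values of `x`. -/
def cfg {V : Type*} {k : ℕ} (x : Fin k → V) : V → Bool := fun v => decide (∃ i, x i = v)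

lemma cfg_eq_true {V : Type*} {k : ℕ} {x : Fin k → V} {v : V} :
    cfg x v = true ↔ ∃ i, x i = v := by simp [cfg]

lemma numParticles_cfg {V : Type*} [Fintype V] {k : ℕ} {x : Fin k → V}
    (hx : Function.Injective x) : numParticles (cfg x) = k := by
  have : (Finset.univ.filter fun v => cfg x v = true) = Finset.univ.image x := by
    ext v; simp [cfg_eq_true]
  rw [numParticles, this, Finset.card_image_of_injective _ hx, Finset.card_univ,
    Fintype.card_fin]

lemma exists_cfg_eq {V : Type*} [Fintype V] {k : ℕ} {S : V → Bool} (hS : numParticles S = k) :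
    ∃ x : Fin k → V, Function.Injective x ∧ cfg x = S := by
  set e := Finset.equivFinOfCardEq hS
  refine ⟨fun i => (e.symm i).1, Subtype.val_injective.comp e.symm.injective, ?_⟩
  ext v
  rw [Bool.eq_iff_iff, cfg_eq_true]
  constructor
  · rintro ⟨i, rfl⟩
    exact (Finset.mem_filter.mp (e.symm i).2).2
  · intro h
    exact ⟨e ⟨v, by simpa using h⟩, by simp⟩

/-- The labelled configuration `x` has pairwise distinct, pairwise nonadjacent particles. -/
def GoodLabel {V : Type*} (G : SimpleGraph V) {k : ℕ} (x : Fin k → V) : Prop :=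
  ∀ i j, i ≠ j → x i ≠ x j ∧ ¬ G.Adj (x i) (x j)

lemma GoodLabel.injective {V : Type*} {G : SimpleGraph V} {k : ℕ} {x : Fin k → V}
    (h : GoodLabel G x) : Function.Injective x := by
  intro i j hij
  by_contra hne
  exact (h i j hne).1 hij

lemma GoodLabel.cfg_mem {V : Type*} [Fintype V] {G : SimpleGraph V} {k : ℕ} {x : Fin k → V}
    (h : GoodLabel G x) : cfg x ∈ OmegaK G k := by
  refine ⟨numParticles_cfg h.injective, ?_⟩
  rintro u v huv ⟨hu, hv⟩
  obtain ⟨i, rfl⟩ := cfg_eq_true.mp hu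
  obtain ⟨j, rfl⟩ := cfg_eq_true.mp hv
  exact (h i j fun e => huv.ne (by rw [e])).2 huv

lemma goodLabel_of_cfg_mem {V : Type*} [Fintype V] {G : SimpleGraph V} {k : ℕ} {x : Fin k → V}
    (hx : Function.Injective x) (h : cfg x ∈ OmegaK G k) : GoodLabel G x :=
  fun i j hij => ⟨fun e => hij (hx e), fun ha =>
    h.2 _ _ ha ⟨cfg_eq_true.mpr ⟨i, rfl⟩, cfg_eq_true.mpr ⟨j, rfl⟩⟩⟩

/-- `T` is obtained from `S` by sliding a particle along an edge to an empty vertex. -/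
def Slide {V : Type*} (G : SimpleGraph V) (S T : V → Bool) : Prop :=
  ∃ u w, G.Adj u w ∧ S u = true ∧ S w = false ∧
    T = Function.update (Function.update S w true) u false

/-- Moving one label of an injective labelling to an empty vertex. -/
lemma cfg_update {V : Type*} {k : ℕ} {x : Fin k → V} (hx : Function.Injective x) (i : Fin k)
    {w : V} (hw : cfg x w = false) :
    cfg (Function.update x i w) =
      Function.update (Function.update (cfg x) w true) (x i) false := by
  have hw' : ∀ j, x j ≠ w := by
    intro j hj
    have := cfg_eq_true.mpr ⟨j, hj⟩
    rw [hw] at this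
    exact absurd this (by simp)
  ext v
  rw [Bool.eq_iff_iff, cfg_eq_true]
  by_cases hv : v = x i
  · subst hv
    simp only [Function.update_self, Bool.false_eq_true, iff_false, not_exists]
    intro j
    by_cases hj : j = i
    · subst hj; rw [Function.update_self]; exact (hw' j).symm
    · rw [Function.update_of_ne hj]; exact fun e => hj (hx e)
  · rw [Function.update_of_ne hv]
    by_cases hvw : v = w
    · subst hvw
      simp only [Function.update_self, iff_true]
      exact ⟨i, by simp⟩
    · rw [Function.update_of_ne hvw, cfg_eq_true]
      constructor
      · rintro ⟨j, hj⟩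
        by_cases hji : j = i
        · subst hji; rw [Function.update_self] at hj; exact absurd hj.symm hvw
        · rw [Function.update_of_ne hji] at hj; exact ⟨j, hj⟩
      · rintro ⟨j, rfl⟩
        refine ⟨j, ?_⟩
        rw [Function.update_of_ne]
        rintro rfl
        exact hv rfl

lemma slide_cfg_update {M d k : ℕ} {x : Fin k → Fin d → ZMod M} {i : Fin k}
    {s : Fin d → ZMod M} (hx : Function.Injective x)
    (hx' : Function.Injective (Function.update x i (x i + s)))
    (hs : s ∈ stepSet M Finset.univ) (hs0 : s ≠ 0) :
    Slide (torusGraph M d) (cfg x) (cfg (Function.update x i (x i + s))) := by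
  have hw : cfg x (x i + s) = false := by
    rw [Bool.eq_false_iff]
    intro h
    obtain ⟨j, hj⟩ := cfg_eq_true.mp h
    by_cases hji : j = i
    · subst hji; exact hs0 (by simpa using hj)
    · exact hji (hx' (by rw [Function.update_self, Function.update_of_ne hji, hj]))
  refine ⟨x i, x i + s, torusGraph_adj.mpr ⟨by simpa using hs0, by simpa using hs⟩,
    cfg_eq_true.mpr ⟨i, rfl⟩, hw, cfg_update hx i hw⟩


/-- `Reach n x y`: the labelled configuration `y` can be reached from `x` in `n` moves, each
displacing at most one particle to a neighbouring vertex, through good configurations. -/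
inductive Reach {M d k : ℕ} :
    ℕ → (Fin k → Fin d → ZMod M) → (Fin k → Fin d → ZMod M) → Prop
  | refl (x) (hx : GoodLabel (torusGraph M d) x) : Reach 0 x x
  | step {n x y} (h : Reach n x y) (i : Fin k) (s : Fin d → ZMod M)
      (hs : s ∈ stepSet M Finset.univ)
      (hg : GoodLabel (torusGraph M d) (Function.update y i (y i + s))) :
      Reach (n + 1) x (Function.update y i (y i + s))

section Reach

variable {M d k : ℕ}

lemma Reach.good_right {n : ℕ} {x y : Fin k → Fin d → ZMod M} (h : Reach n x y) :
    GoodLabel (torusGraph M d) y := by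
  cases h <;> assumption

lemma Reach.trans {m n : ℕ} {x y z : Fin k → Fin d → ZMod M} (h : Reach m x y)
    (h' : Reach n y z) : Reach (m + n) x z := by
  induction h' with
  | refl => exact h
  | step _ i s hs hg ih => exact Reach.step (ih h) i s hs hg

lemma Reach.sub_mem {n : ℕ} {x y : Fin k → Fin d → ZMod M} (h : Reach n x y) (j : Fin k) :
    y j - x j ∈ n • stepSet M (Finset.univ : Finset (Fin d)) := by
  induction h with
  | refl => simp
  | @step n x y _ i s hs hg ih =>
    rw [succ_nsmul]
    by_cases hj : j = i
    · subst hj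
      rw [Function.update_self, add_sub_right_comm]
      exact Finset.add_mem_add ih hs
    · rw [Function.update_of_ne hj, ← add_zero (y j - x j)]
      exact Finset.add_mem_add ih (zero_mem_stepSet _)

/-- The `b`-coordinates of the particles are pairwise at distance at least two. -/
def SepCoord (b : Fin d) (x : Fin k → Fin d → ZMod M) : Prop :=
  ∀ i j, i ≠ j → x i b ≠ x j b ∧ x i b ≠ x j b + 1

lemma SepCoord.congr {b : Fin d} {x y : Fin k → Fin d → ZMod M} (h : SepCoord b x)
    (hxy : ∀ i, y i b = x i b) : SepCoord b y := by
  intro i j hij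
  rw [hxy, hxy]
  exact h i j hij

lemma eq_or_of_adj {u v : Fin d → ZMod M} (h : (torusGraph M d).Adj u v) (b : Fin d) :
    u b = v b ∨ u b = v b + 1 ∨ v b = u b + 1 := by
  have h2 := (torusGraph_adj.mp h).2
  rcases mem_stepSet.mp h2 with h0 | ⟨a, -, h0 | h0⟩
  · exact Or.inl (by rw [sub_eq_zero.mp h0])
  · have : v b = u b + (Pi.single a 1 : Fin d → ZMod M) b := by rw [← h0]; simp
    by_cases hb : b = a
    · subst hb; right; right; simpa using this
    · left; rw [this, Pi.single_eq_of_ne hb, add_zero]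
  · have : u b = v b + (Pi.single a 1 : Fin d → ZMod M) b := by
      rw [← neg_eq_iff_eq_neg] at h0; rw [← h0]; simp
    by_cases hb : b = a
    · subst hb; right; left; simpa using this
    · left; rw [this, Pi.single_eq_of_ne hb, add_zero]

lemma SepCoord.good {b : Fin d} {x : Fin k → Fin d → ZMod M} (h : SepCoord b x) :
    GoodLabel (torusGraph M d) x := by
  intro i j hij
  refine ⟨fun e => (h i j hij).1 (by rw [e]), fun ha => ?_⟩
  rcases eq_or_of_adj ha b with h' | h' | h'
  · exact (h i j hij).1 h'
  · exact (h i j hij).2 h'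
  · exact (h j i hij.symm).2 h'

lemma SepCoord.reach_update {b : Fin d} {x : Fin k → Fin d → ZMod M} (h : SepCoord b x)
    (i : Fin k) {n : ℕ} {w : Fin d → ZMod M}
    (hw : w ∈ n • stepSet M (Finset.univ.erase b)) :
    Reach n x (Function.update x i (x i + w)) := by
  induction n generalizing w with
  | zero =>
    have : w = 0 := by simpa using hw
    subst this
    rw [add_zero, Function.update_eq_self]
    exact Reach.refl x h.good
  | succ n ih =>
    have hw0 := hw
    rw [succ_nsmul] at hw
    obtain ⟨u, hu, s, hs, rfl⟩ := Finset.mem_add.mp hw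
    have hz := apply_eq_zero_of_mem_nsmul (Finset.notMem_erase b _) hw0
    have e : Function.update x i (x i + (u + s)) =
        Function.update (Function.update x i (x i + u)) i
          (Function.update x i (x i + u) i + s) := by
      rw [Function.update_idem, Function.update_self, add_assoc]
    rw [e]
    refine Reach.step (ih hu) i s (stepSet_mono (Finset.subset_univ _) hs) ?_
    rw [← e]
    refine (h.congr fun j => ?_).good (b := b)
    by_cases hj : j = i
    · subst hj
      rw [Function.update_self, Pi.add_apply, hz, add_zero]
    · rw [Function.update_of_ne hj]

/-- When the `b`-coordinates are separated, particles move freely in the other directions. -/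
lemma SepCoord.reach_add {b : Fin d} {x v : Fin k → Fin d → ZMod M} (h : SepCoord b x) {n : ℕ}
    (hv : ∀ i, v i ∈ n • stepSet M (Finset.univ.erase b)) : Reach (k * n) x (x + v) := by
  have key : ∀ s : Finset (Fin k),
      Reach (s.card * n) x (fun j => if j ∈ s then x j + v j else x j) := by
    intro s
    induction s using Finset.induction_on with
    | empty => simpa using Reach.refl x h.good
    | insert i s hi ih =>
      rw [Finset.card_insert_of_notMem hi, add_mul, one_mul]
      have hsep : SepCoord b (fun j => if j ∈ s then x j + v j else x j) := by
        refine h.congr fun j => ?_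
        split_ifs
        · rw [Pi.add_apply, apply_eq_zero_of_mem_nsmul (Finset.notMem_erase b _) (hv j), add_zero]
        · rfl
      have h2 := ih.trans (hsep.reach_update i (hv i))
      convert h2 using 1
      ext1 j
      by_cases hj : j = i
      · subst hj; simp [hi]
      · simp [hj]
  have := key Finset.univ
  rw [Finset.card_univ, Fintype.card_fin] at this
  convert this using 1
  ext1 j
  simp

/-- Some cut of the cycle leaves room for a window of `W` sites without particles. -/
lemma exists_cut [NeZero M] (x : Fin k → ZMod M) {W : ℕ} (hW : k * W < M) :
    ∃ g : ZMod M, ∀ i, (x i - g).val < M - W := by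
  by_contra! hcon
  have h1 : (Finset.univ : Finset (ZMod M)) ⊆ (Finset.univ : Finset (Fin k)).biUnion fun i =>
      (Finset.range W).image fun j => x i - ((M - W + j : ℕ) : ZMod M) := by
    intro g _
    obtain ⟨i, hi⟩ := hcon g
    simp only [Finset.mem_biUnion, Finset.mem_image, Finset.mem_range, Finset.mem_univ, true_and]
    have hlt := ZMod.val_lt (x i - g)
    refine ⟨i, (x i - g).val - (M - W), by omega, ?_⟩
    have : M - W + ((x i - g).val - (M - W)) = (x i - g).val := by omega
    rw [this, ZMod.natCast_zmod_val]
    abel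
  have h2 := Finset.card_le_card h1
  rw [Finset.card_univ, ZMod.card] at h2
  have h3 := Finset.card_biUnion_le_card_mul (Finset.univ : Finset (Fin k))
    (fun i => (Finset.range W).image fun j => x i - ((M - W + j : ℕ) : ZMod M)) W
    fun i _ => Finset.card_image_le.trans (by simp)
  rw [Finset.card_univ, Fintype.card_fin] at h3
  omega

lemma natCast_ne_of_lt {p q : ℕ} (hpq : p < q) (hq : q < M) : (q : ZMod M) ≠ p := by
  intro h
  rw [ZMod.natCast_eq_natCast_iff', Nat.mod_eq_of_lt hq, Nat.mod_eq_of_lt (hpq.trans hq)] at h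
  omega

/-- A monotone raise of the heights, with lower particles raised only when all higher ones are
raised strictly more, preserves goodness. -/
lemma good_raise [NeZero M] {a : Fin d} {x : Fin k → Fin d → ZMod M}
    (hx : GoodLabel (torusGraph M d) x) {g : ZMod M} {H : ℕ} (key : Fin k → ℕ)
    (hinj : Function.Injective key)
    (hkey : ∀ i j, key i < key j → (x i a - g).val ≤ (x j a - g).val)
    (s : Fin k → ℕ) (hs : ∀ i, (x i a - g).val + s i ≤ H) (hH : H + 1 < M)
    (hcrit : ∀ i j, key i < key j → s i = 0 ∨ s i + 2 ≤ s j) :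
    GoodLabel (torusGraph M d) (fun i => x i + s i • Pi.single a (1 : ZMod M)) := by
  have hcoord : ∀ i, (x i + s i • Pi.single a (1 : ZMod M) : Fin d → ZMod M) a =
      g + (((x i a - g).val + s i : ℕ) : ZMod M) := by
    intro i
    push_cast
    rw [ZMod.natCast_zmod_val]
    simp
    ring
  have hother : ∀ i c, c ≠ a → (x i + s i • Pi.single a (1 : ZMod M) : Fin d → ZMod M) c = x i c := by
    intro i c hc
    simp [hc]
  have main : ∀ i j, key i < key j →
      x i + s i • Pi.single a (1 : ZMod M) ≠ x j + s j • Pi.single a (1 : ZMod M) ∧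
      ¬ (torusGraph M d).Adj (x i + s i • Pi.single a (1 : ZMod M))
        (x j + s j • Pi.single a (1 : ZMod M)) := by
    intro i j hij
    have hne : i ≠ j := fun e => by subst e; exact lt_irrefl _ hij
    by_cases hz : s i = 0 ∧ s j = 0
    · rw [hz.1, hz.2]
      simpa using hx i j hne
    have ht := hkey i j hij
    have hc := hcrit i j hij
    have hi := hs i
    have hj := hs j
    set p := (x i a - g).val + s i with hp
    set q := (x j a - g).val + s j with hq
    have hpq : p < q := by omega
    have hcast : (q : ZMod M) ≠ p := natCast_ne_of_lt hpq (by omega)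
    have hcast2 : ((q + 1 : ℕ) : ZMod M) ≠ p := natCast_ne_of_lt (by omega) (by omega)
    refine ⟨fun e => ?_, fun ha => ?_⟩
    · have := congrFun e a
      rw [hcoord, hcoord] at this
      exact hcast (add_left_cancel this).symm
    · have h3 : (q : ZMod M) = p + 1 := by
        rcases eq_or_of_adj ha a with h | h | h <;> rw [hcoord, hcoord] at h
        · exact absurd (add_left_cancel h).symm hcast
        · rw [add_assoc] at h
          exact absurd (by push_cast; exact (add_left_cancel h).symm) hcast2
        · rw [add_assoc] at h
          exact add_left_cancel h
      have h4 : q = p + 1 := by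
        by_contra hne'
        refine natCast_ne_of_lt (M := M) (p := p + 1) (q := q) (by omega) (by omega) ?_
        push_cast
        exact h3
      have h5 : (x i a - g).val = (x j a - g).val := by omega
      have h6 : x i a = x j a := sub_left_injective (ZMod.val_injective M h5)
      refine (hx i j hne).1 (funext fun c => ?_)
      by_cases hca : c = a
      · rw [hca, h6]
      rw [← hother i c hca, ← hother j c hca]
      have h7 : ((x j + s j • Pi.single a (1 : ZMod M)) -
          (x i + s i • Pi.single a (1 : ZMod M))) ∈ stepSet M (Finset.univ : Finset (Fin d)) :=
        (torusGraph_adj.mp ha).2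
      have h8 : (1 : ZMod M) ≠ 0 := by
        have := natCast_ne_of_lt (M := M) (p := 0) (q := 1) (by omega) (by omega)
        simpa using this
      have hva : ((x j + s j • Pi.single a (1 : ZMod M)) -
          (x i + s i • Pi.single a (1 : ZMod M)) : Fin d → ZMod M) a = 1 := by
        rw [Pi.sub_apply, hcoord, hcoord, ← hp, ← hq, h4]
        push_cast
        ring
      rcases mem_stepSet.mp h7 with h0 | ⟨e, -, h0⟩
      · rw [h0] at hva
        exact absurd hva.symm h8
      · have hea : a = e := by
          by_contra hne'
          rcases h0 with h0 | h0 <;> rw [h0] at hva <;> simp [hne'] at hva <;>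
            exact h8 hva.symm
        have hz : ((x j + s j • Pi.single a (1 : ZMod M)) -
          (x i + s i • Pi.single a (1 : ZMod M)) : Fin d → ZMod M) c = 0 := by
          rw [hea] at hca
          rcases h0 with h0 | h0 <;> rw [h0] <;> simp [hca]
        rw [Pi.sub_apply, sub_eq_zero] at hz
        exact hz.symm
  intro i j hij
  rcases lt_or_gt_of_ne (fun e => hij (hinj e) : key i ≠ key j) with h | h
  · exact main i j h
  · exact ⟨fun e => (main j i h).1 e.symm, fun ha => (main j i h).2 ha.symm⟩

lemma reach_raise [NeZero M] {a : Fin d} {x : Fin k → Fin d → ZMod M}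
    (hx : GoodLabel (torusGraph M d) x) {g : ZMod M} {H : ℕ} (key : Fin k → ℕ)
    (hinj : Function.Injective key)
    (hkey : ∀ i j, key i < key j → (x i a - g).val ≤ (x j a - g).val) (hH : H + 1 < M)
    (n : ℕ) (s : Fin k → ℕ) (hn : ∑ i, s i = n) (hs : ∀ i, (x i a - g).val + s i ≤ H)
    (hcrit : ∀ i j, key i < key j → s i = 0 ∨ s i + 2 ≤ s j) :
    Reach n x (fun i => x i + s i • Pi.single a (1 : ZMod M)) := by
  induction n generalizing s with
  | zero =>
    have : ∀ i, s i = 0 := by simpa using hn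
    simpa [this] using Reach.refl x hx
  | succ n ih =>
    have hne : (Finset.univ.filter fun i => s i ≠ 0).Nonempty := by
      by_contra hemp
      rw [Finset.not_nonempty_iff_eq_empty, Finset.filter_eq_empty_iff] at hemp
      have : ∑ i, s i = 0 := Finset.sum_eq_zero fun i hi => by simpa using hemp hi
      omega
    obtain ⟨i, hi, hmin⟩ := Finset.exists_min_image _ key hne
    have hi0 : s i ≠ 0 := (Finset.mem_filter.mp hi).2
    have hmin' : ∀ j, key j < key i → s j = 0 := by
      intro j hj
      by_contra h
      have := hmin j (Finset.mem_filter.mpr ⟨Finset.mem_univ _, h⟩)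
      omega
    have hsum : ∑ j, Function.update s i (s i - 1) j = n := by
      have h1 := Finset.sum_update_of_mem (Finset.mem_univ i) s (s i - 1)
      have h2 := Finset.add_sum_erase Finset.univ s (Finset.mem_univ i)
      rw [← Finset.erase_eq] at h1
      omega
    have h1 := ih (Function.update s i (s i - 1)) hsum (fun j => by
        by_cases hj : j = i
        · subst hj; rw [Function.update_self]; have := hs j; omega
        · rw [Function.update_of_ne hj]; exact hs j) (fun j l hjl => by
        have hc := hcrit j l hjl
        by_cases hj : j = i
        · subst hj
          have hl : l ≠ j := fun e => by subst e; exact lt_irrefl _ hjl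
          rw [Function.update_self, Function.update_of_ne hl]
          omega
        · rw [Function.update_of_ne hj]
          by_cases hl : l = i
          · subst hl
            left; exact hmin' j hjl
          · rw [Function.update_of_ne hl]; exact hc)
    have e : (fun j => x j + s j • Pi.single a (1 : ZMod M)) =
        Function.update (fun j => x j + Function.update s i (s i - 1) j • Pi.single a (1 : ZMod M))
          i ((fun j => x j + Function.update s i (s i - 1) j • Pi.single a (1 : ZMod M)) i +
            Pi.single a 1) := by
      ext1 j
      by_cases hj : j = i
      · subst hj
        simp only [Function.update_self]
        rw [add_assoc, ← succ_nsmul, Nat.sub_add_cancel (Nat.one_le_iff_ne_zero.mpr hi0)]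
      · simp only [Function.update_of_ne hj]
    rw [e]
    refine Reach.step h1 i _ (mem_stepSet.mpr (Or.inr ⟨a, Finset.mem_univ _, Or.inl rfl⟩)) ?_
    rw [← e]
    exact good_raise hx key hinj hkey s hs hH hcrit

/-- Any injective labelled configuration can be stretched in direction `a` by bounded amounts
so that the `a`-coordinates become separated; good configurations stay good on the way. -/
lemma exists_stretch [NeZero M] (a : Fin d) {x : Fin k → Fin d → ZMod M}
    (hM : k * (2 * k + 2) < M) (hk : 0 < k) :
    ∃ m : Fin k → ℕ, (∀ i, m i ≤ 2 * k) ∧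
      SepCoord a (fun i => x i + m i • Pi.single a (1 : ZMod M)) ∧
      (GoodLabel (torusGraph M d) x →
        ∃ n ≤ 2 * k * k, Reach n x (fun i => x i + m i • Pi.single a (1 : ZMod M))) := by
  obtain ⟨g, hg⟩ := exists_cut (fun i => x i a) hM
  set t : Fin k → ℕ := fun i => (x i a - g).val with ht
  set key : Fin k → ℕ := fun i => t i * k + i with hkeydef
  have hkey : ∀ i j, key i < key j → t i ≤ t j := by
    intro i j hij
    by_contra! h
    have h1 : (t j + 1) * k ≤ t i * k := Nat.mul_le_mul_right k h
    have hi := i.2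
    have hj := j.2
    simp only [hkeydef] at hij
    rw [add_mul] at h1
    omega
  have hinj : Function.Injective key := by
    intro i j hij
    have h1 : key i % k = key j % k := by rw [hij]
    simp only [hkeydef, Nat.mul_add_mod_self_right, Nat.mod_eq_of_lt i.2, Nat.mod_eq_of_lt j.2] at h1
    exact Fin.ext h1
  set rank : Fin k → ℕ := fun i => (Finset.univ.filter fun j => key j < key i).card with hrank
  have hrank_lt : ∀ i j, key i < key j → rank i + 1 ≤ rank j := by
    intro i j hij
    refine Finset.card_lt_card ⟨fun l hl => ?_, fun hsub => ?_⟩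
    · simp only [Finset.mem_filter, Finset.mem_univ, true_and] at hl ⊢
      omega
    · have := hsub (Finset.mem_filter.mpr ⟨Finset.mem_univ i, hij⟩)
      simp at this
  have hrank_le : ∀ i, rank i ≤ k := fun i => by
    simpa using Finset.card_le_univ (Finset.univ.filter fun j => key j < key i)
  have hkW : 2 * k + 2 ≤ k * (2 * k + 2) := Nat.le_mul_of_pos_left _ hk
  have hbound : ∀ i, t i + 2 * rank i ≤ M - 3 := by
    intro i
    have h1 : t i < M - (2 * k + 2) := hg i
    have h2 := hrank_le i
    omega
  refine ⟨fun i => 2 * rank i, fun i => Nat.mul_le_mul_left 2 (hrank_le i), ?_, ?_⟩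
  · have hcoord : ∀ i, (x i + (2 * rank i) • Pi.single a (1 : ZMod M) : Fin d → ZMod M) a =
        g + ((t i + 2 * rank i : ℕ) : ZMod M) := by
      intro i
      push_cast
      rw [ht, ZMod.natCast_zmod_val]
      simp
      ring
    intro i j hij
    simp only [hcoord]
    have hi := hbound i
    have hj := hbound j
    rcases lt_or_gt_of_ne (fun e => hij (hinj e) : key i ≠ key j) with h | h
    · have h1 := hkey i j h
      have h2 := hrank_lt i j h
      refine ⟨fun e => ?_, fun e => ?_⟩
      · exact natCast_ne_of_lt (M := M) (p := t i + 2 * rank i) (q := t j + 2 * rank j)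
          (by omega) (by omega) (add_left_cancel e).symm
      · rw [add_assoc] at e
        refine natCast_ne_of_lt (M := M) (q := t j + 2 * rank j + 1) (p := t i + 2 * rank i)
          (by omega) (by omega) ?_
        rw [Nat.cast_add_one]
        exact (add_left_cancel e).symm
    · have h1 := hkey j i h
      have h2 := hrank_lt j i h
      refine ⟨fun e => ?_, fun e => ?_⟩
      · exact natCast_ne_of_lt (M := M) (p := t j + 2 * rank j) (q := t i + 2 * rank i)
          (by omega) (by omega) (add_left_cancel e)
      · rw [add_assoc] at e
        refine natCast_ne_of_lt (M := M) (q := t i + 2 * rank i) (p := t j + 2 * rank j + 1)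
          (by omega) (by omega) ?_
        rw [Nat.cast_add_one]
        exact add_left_cancel e
  · intro hx
    refine ⟨∑ i, 2 * rank i, ?_, ?_⟩
    · refine (Finset.sum_le_card_nsmul _ _ (2 * k) fun i _ =>
        Nat.mul_le_mul_left 2 (hrank_le i)).trans ?_
      simp [mul_comm]
    · exact reach_raise hx key hinj hkey (H := M - 3) (by omega) _ _ rfl hbound
        fun i j hij => Or.inr (by have := hrank_lt i j hij; omega)

/-- Separated configurations at bounded displacement are connected by boundedly many moves. -/
lemma exists_reach_of_sep [NeZero M] {a b : Fin d} (hab : a ≠ b)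
    (hM : k * (2 * k + 2) < M) (hk : 0 < k) {x x' : Fin k → Fin d → ZMod M} {m m' : Fin k → ℕ}
    (hm : ∀ i, m i ≤ 2 * k) (hm' : ∀ i, m' i ≤ 2 * k)
    (hxx' : ∀ i, x' i - x i ∈ stepSet M Finset.univ)
    (hy : SepCoord a (fun i => x i + m i • Pi.single a (1 : ZMod M)))
    (hy' : SepCoord a (fun i => x' i + m' i • Pi.single a (1 : ZMod M))) :
    Reach (k * (2 * k) + k * (4 * k + 1) + k * (2 * k + 1))
      (fun i => x i + m i • Pi.single a (1 : ZMod M))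
      (fun i => x' i + m' i • Pi.single a (1 : ZMod M)) := by
  set y := fun i => x i + m i • Pi.single a (1 : ZMod M) with hydef
  set y' := fun i => x' i + m' i • Pi.single a (1 : ZMod M) with hydef'
  obtain ⟨r, hr, hz, -⟩ := exists_stretch b (x := y) hM hk
  have hsplit : ∀ i, ∃ u₁ u₂, x' i - x i = u₁ + u₂ ∧
      u₁ ∈ stepSet M (Finset.univ.erase b) ∧ u₂ ∈ stepSet M (Finset.univ.erase a) := by
    intro i
    rcases mem_stepSet.mp (hxx' i) with h | ⟨c, -, h⟩
    · exact ⟨0, 0, by rw [h, add_zero], zero_mem_stepSet _, zero_mem_stepSet _⟩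
    · by_cases hc : c = b
      · exact ⟨0, x' i - x i, by rw [zero_add], zero_mem_stepSet _, mem_stepSet.mpr
          (Or.inr ⟨c, Finset.mem_erase.mpr ⟨by rw [hc]; exact hab.symm, Finset.mem_univ _⟩, h⟩)⟩
      · exact ⟨x' i - x i, 0, by rw [add_zero], mem_stepSet.mpr
          (Or.inr ⟨c, Finset.mem_erase.mpr ⟨hc, Finset.mem_univ _⟩, h⟩), zero_mem_stepSet _⟩
  choose u₁ u₂ hu hu₁ hu₂ using hsplit
  have hb : b ∈ Finset.univ.erase a := Finset.mem_erase.mpr ⟨hab.symm, Finset.mem_univ _⟩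
  have ha : a ∈ Finset.univ.erase b := Finset.mem_erase.mpr ⟨hab, Finset.mem_univ _⟩
  have hrmem : ∀ i, r i • Pi.single b (1 : ZMod M) ∈ (2 * k) • stepSet M (Finset.univ.erase a) :=
    fun i => nsmul_stepSet_mono (Finset.Subset.refl _) (hr i) (nsmul_single_mem hb _)
  have h1 := hy.reach_add (v := fun i => r i • Pi.single b (1 : ZMod M)) hrmem
  have hv : ∀ i, m' i • Pi.single a (1 : ZMod M) + -(m i • Pi.single a (1 : ZMod M)) + u₁ i ∈
      (4 * k + 1) • stepSet M (Finset.univ.erase b) := by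
    intro i
    have e1 := nsmul_stepSet_mono (Finset.Subset.refl _) (hm' i)
      (nsmul_single_mem (M := M) ha (m' i))
    have e2 := neg_mem_nsmul_stepSet (nsmul_stepSet_mono (Finset.Subset.refl _) (hm i)
      (nsmul_single_mem (M := M) ha (m i)))
    have e3 := add_mem_nsmul_stepSet (add_mem_nsmul_stepSet e1 e2)
      (n := 1) (t := u₁ i) (by rw [one_nsmul]; exact hu₁ i)
    convert e3 using 2
    omega
  have h2 := SepCoord.reach_add hz hv
  set w := (fun i => y i + r i • Pi.single b (1 : ZMod M)) +
    (fun i => m' i • Pi.single a (1 : ZMod M) + -(m i • Pi.single a (1 : ZMod M)) + u₁ i) with hw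
  have hv' : ∀ i, -(r i • Pi.single b (1 : ZMod M)) + u₂ i ∈
      (2 * k + 1) • stepSet M (Finset.univ.erase a) := fun i =>
    add_mem_nsmul_stepSet (neg_mem_nsmul_stepSet (hrmem i)) (by rw [one_nsmul]; exact hu₂ i)
  have hwy' : w + (fun i => -(r i • Pi.single b (1 : ZMod M)) + u₂ i) = y' := by
    ext1 i
    have : x' i = x i + (u₁ i + u₂ i) := by rw [← hu i]; abel
    simp only [hw, hydef, hydef', Pi.add_apply, this]
    abel
  have hwsep : SepCoord a w := by
    refine hy'.congr fun i => ?_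
    have := congrFun (congrFun hwy' i) a
    rw [← this, Pi.add_apply, Pi.add_apply,
      apply_eq_zero_of_mem_nsmul (Finset.notMem_erase a _) (hv' i), add_zero]
  have h3 := hwsep.reach_add hv'
  rw [hwy'] at h3
  exact (h1.trans h2).trans h3

end Reach


/-- Extension of a function on `Ω_k` to all configurations by zero. -/
def extendZero {V : Type*} [Fintype V] {G : SimpleGraph V} {k : ℕ} (f : OmegaK G k → ℝ)
    (S : V → Bool) : ℝ :=
  if h : S ∈ OmegaK G k then f ⟨S, h⟩ else 0

section Extension

variable {M d k : ℕ}

/-- `F` varies by at most `D` along moves of one particle near the labelled configuration `x₀`. -/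
def LocalBound (F : ((Fin d → ZMod M) → Bool) → ℝ) (x₀ : Fin k → Fin d → ZMod M) (R : ℕ)
    (D : ℝ) : Prop :=
  ∀ x i s, GoodLabel (torusGraph M d) x →
    GoodLabel (torusGraph M d) (Function.update x i (x i + s)) →
    s ∈ stepSet M Finset.univ → (∀ j, x j - x₀ j ∈ R • stepSet M Finset.univ) →
    |F (cfg x) - F (cfg (Function.update x i (x i + s)))| ≤ D

variable {F : ((Fin d → ZMod M) → Bool) → ℝ} {x₀ : Fin k → Fin d → ZMod M} {R : ℕ} {D : ℝ}

lemma LocalBound.reach (h : LocalBound F x₀ R D) {n r : ℕ} {x y : Fin k → Fin d → ZMod M}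
    (hr : Reach n x y) (hx : ∀ j, x j - x₀ j ∈ r • stepSet M Finset.univ) (hR : r + n ≤ R) :
    |F (cfg x) - F (cfg y)| ≤ n * D := by
  induction hr with
  | refl => simp
  | @step n x y hr i s hs hg ih =>
    have h1 := ih hx (by omega)
    have h2 := h y i s hr.good_right hg hs fun j => by
      have := add_mem_nsmul_stepSet (hx j) (hr.sub_mem j)
      rw [show x j - x₀ j + (y j - x j) = y j - x₀ j by abel] at this
      exact nsmul_stepSet_mono (Finset.Subset.refl _) (by omega) this
    have h3 := abs_sub_le (F (cfg x)) (F (cfg y)) (F (cfg (Function.update y i (y i + s))))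
    push_cast
    linarith

lemma LocalBound.shift (h : LocalBound F x₀ (R + 1) D) {x₁ : Fin k → Fin d → ZMod M}
    (h₁ : ∀ j, x₁ j - x₀ j ∈ stepSet M Finset.univ) : LocalBound F x₁ R D := by
  intro x i s hx hx' hs hR
  refine h x i s hx hx' hs fun j => ?_
  have := add_mem_nsmul_stepSet (hR j) (n := 1) (by rw [one_nsmul]; exact h₁ j)
  rwa [show x j - x₁ j + (x₁ j - x₀ j) = x j - x₀ j by abel] at this

lemma exists_common_stretch [NeZero M] (a : Fin d) (hM : k * (2 * k + 2) < M) (hk : 0 < k)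
    (S : (Fin d → ZMod M) → Bool) :
    ∃ T, ∀ x : Fin k → Fin d → ZMod M, Function.Injective x → cfg x = S →
      ∃ m : Fin k → ℕ, (∀ i, m i ≤ 2 * k) ∧
        SepCoord a (fun i => x i + m i • Pi.single a (1 : ZMod M)) ∧
        cfg (fun i => x i + m i • Pi.single a (1 : ZMod M)) = T := by
  by_cases hS : ∃ x₀ : Fin k → Fin d → ZMod M, Function.Injective x₀ ∧ cfg x₀ = S
  swap
  · exact ⟨S, fun x hx hxS => absurd ⟨x, hx, hxS⟩ hS⟩
  obtain ⟨x₀, hx₀, rfl⟩ := hS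
  obtain ⟨m, hm, hsep, -⟩ := exists_stretch (k := k) a (x := x₀) hM hk
  refine ⟨cfg fun i => x₀ i + m i • Pi.single a (1 : ZMod M), fun x hx hxS => ?_⟩
  have hσ : ∀ i, ∃ j, x₀ j = x i := fun i =>
    cfg_eq_true.mp (by rw [← hxS]; exact cfg_eq_true.mpr ⟨i, rfl⟩)
  choose σ hσ using hσ
  have hσi : Function.Injective σ := fun i j hij => hx (by rw [← hσ i, ← hσ j, hij])
  have hσs : Function.Surjective σ := Finite.surjective_of_injective hσi
  refine ⟨fun i => m (σ i), fun i => hm _, fun i j hij => ?_, ?_⟩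
  · have := hsep (σ i) (σ j) fun e => hij (hσi e)
    simpa only [hσ] using this
  · ext v
    rw [Bool.eq_iff_iff, cfg_eq_true, cfg_eq_true]
    constructor
    · rintro ⟨i, hi⟩
      exact ⟨σ i, by rw [hσ]; exact hi⟩
    · rintro ⟨j, hj⟩
      obtain ⟨i, rfl⟩ := hσs j
      exact ⟨i, by rw [← hσ]; exact hj⟩

/-- Extension of a function on `Ω_k` to all `k`-particle configurations: a configuration outside
`Ω_k` is first stretched into `Ω_k`. -/
lemma exists_extension [NeZero M] (a : Fin d) (hM : k * (2 * k + 2) < M) (hk : 0 < k)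
    (f : OmegaK (torusGraph M d) k → ℝ) :
    ∃ g : ((Fin d → ZMod M) → Bool) → ℝ, (∀ S : OmegaK (torusGraph M d) k, g S.1 = f S) ∧
      ∀ x : Fin k → Fin d → ZMod M, Function.Injective x →
        ∃ m : Fin k → ℕ, (∀ i, m i ≤ 2 * k) ∧
          SepCoord a (fun i => x i + m i • Pi.single a (1 : ZMod M)) ∧
          ∀ R D, 0 ≤ D → 2 * k * k ≤ R → LocalBound (extendZero f) x R D →
            |g (cfg x) - extendZero f (cfg fun i => x i + m i • Pi.single a (1 : ZMod M))| ≤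
              (2 * k * k : ℕ) * D := by
  choose T hT using exists_common_stretch (k := k) (M := M) a hM hk
  refine ⟨fun S => if S ∈ OmegaK (torusGraph M d) k then extendZero f S else extendZero f (T S),
    fun S => ?_, fun x hx => ?_⟩
  · beta_reduce
    rw [if_pos S.2, extendZero, dif_pos S.2]
  · by_cases hS : cfg x ∈ OmegaK (torusGraph M d) k
    · obtain ⟨m, hm, hsep, hreach⟩ := exists_stretch (k := k) a (x := x) hM hk
      obtain ⟨n, hn, hreach⟩ := hreach (goodLabel_of_cfg_mem hx hS)
      refine ⟨m, hm, hsep, fun R D hD hR hloc => ?_⟩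
      beta_reduce
      rw [if_pos hS]
      refine (hloc.reach (r := 0) hreach (fun j => by simp) (by omega)).trans ?_
      exact mul_le_mul_of_nonneg_right (by exact_mod_cast hn) hD
    · obtain ⟨m, hm, hsep, hcfg⟩ := hT (cfg x) x hx rfl
      refine ⟨m, hm, hsep, fun R D hD hR hloc => ?_⟩
      beta_reduce
      rw [if_neg hS, hcfg, sub_self, abs_zero]
      positivity

/-- The number of moves used to compare neighbouring configurations. -/
def pathLength (k : ℕ) : ℕ :=
  2 * k * k + (k * (2 * k) + k * (4 * k + 1) + k * (2 * k + 1)) + 2 * k * k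

/-- The distance within which particles stay during these moves. -/
def pathRadius (k : ℕ) : ℕ := pathLength k + 2 * k + 1

lemma abs_extension_sub_le [NeZero M] {a b : Fin d} (hab : a ≠ b)
    (hM : k * (2 * k + 2) < M) (hk : 0 < k) {f : OmegaK (torusGraph M d) k → ℝ}
    {g : ((Fin d → ZMod M) → Bool) → ℝ}
    (hg : ∀ x : Fin k → Fin d → ZMod M, Function.Injective x →
        ∃ m : Fin k → ℕ, (∀ i, m i ≤ 2 * k) ∧
          SepCoord a (fun i => x i + m i • Pi.single a (1 : ZMod M)) ∧
          ∀ R D, 0 ≤ D → 2 * k * k ≤ R → LocalBound (extendZero f) x R D →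
            |g (cfg x) - extendZero f (cfg fun i => x i + m i • Pi.single a (1 : ZMod M))| ≤
              (2 * k * k : ℕ) * D)
    {x x' : Fin k → Fin d → ZMod M} (hx : Function.Injective x) (hx' : Function.Injective x')
    (hxx' : ∀ i, x' i - x i ∈ stepSet M Finset.univ) (hD : 0 ≤ D)
    (hloc : LocalBound (extendZero f) x (pathRadius k) D) :
    |g (cfg x) - g (cfg x')| ≤ pathLength k * D := by
  obtain ⟨m, hm, hsep, h1⟩ := hg x hx
  obtain ⟨m', hm', hsep', h2⟩ := hg x' hx'
  have e1 := h1 _ D hD (by unfold pathRadius pathLength; omega) hloc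
  have e2 := h2 (pathLength k + 2 * k) D hD (by unfold pathLength; omega) (hloc.shift hxx')
  have e3 := hloc.reach (exists_reach_of_sep hab hM hk hm hm' hxx' hsep hsep') (r := 2 * k)
    (fun j => by
      rw [add_sub_cancel_left]
      exact nsmul_stepSet_mono (Finset.Subset.refl _) (hm j)
        (nsmul_single_mem (Finset.mem_univ a) _))
    (by unfold pathRadius pathLength; omega)
  have e4 := abs_sub_le (g (cfg x))
    (extendZero f (cfg fun i => x i + m i • Pi.single a (1 : ZMod M))) (g (cfg x'))
  have e5 := abs_sub_le (extendZero f (cfg fun i => x i + m i • Pi.single a (1 : ZMod M)))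
    (extendZero f (cfg fun i => x' i + m' i • Pi.single a (1 : ZMod M))) (g (cfg x'))
  rw [abs_sub_comm] at e2
  have e6 : (pathLength k : ℝ) * D = ((2 * k * k : ℕ) : ℝ) * D +
      ((k * (2 * k) + k * (4 * k + 1) + k * (2 * k + 1) : ℕ) : ℝ) * D +
      ((2 * k * k : ℕ) : ℝ) * D := by
    unfold pathLength; push_cast; ring
  linarith

/-- Every particle of `S` is within distance `R` of some particle of `T`. -/
def Close (R : ℕ) (S T : (Fin d → ZMod M) → Bool) : Prop :=
  ∀ v, S v = true → ∃ w, T w = true ∧ w - v ∈ R • stepSet M (Finset.univ : Finset (Fin d))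

lemma card_close_le [NeZero M] (R : ℕ) {T : (Fin d → ZMod M) → Bool}
    (hT : numParticles T = k) :
    (Finset.univ.filter fun S : {z : (Fin d → ZMod M) → Bool // numParticles z = k} =>
      Close R S.1 T).card ≤ 2 ^ (k * (2 * d + 1) ^ R) := by
  set W := (Finset.univ.filter fun v => T v = true) -
    R • stepSet M (Finset.univ : Finset (Fin d)) with hW
  have hWcard : W.card ≤ k * (2 * d + 1) ^ R := by
    refine Finset.card_sub_le.trans ?_
    refine Nat.mul_le_mul (le_of_eq hT) (Finset.card_nsmul_le.trans ?_)
    exact Nat.pow_le_pow_left (card_stepSet_le _) R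
  calc _ ≤ W.powerset.card := by
        refine Finset.card_le_card_of_injOn
          (fun S => Finset.univ.filter fun v => S.1 v = true) ?_ ?_
        · intro S hS
          simp only [Finset.coe_filter, Finset.mem_univ, true_and, Set.mem_ofPred_eq] at hS
          simp only [Finset.coe_powerset, Set.mem_preimage, Set.mem_powerset_iff,
            Finset.coe_subset]
          intro v hv
          obtain ⟨w, hw, hwv⟩ := hS v (Finset.mem_filter.mp hv).2
          rw [hW, Finset.mem_sub]
          exact ⟨w, by simpa using hw, w - v, hwv, by abel⟩
        · intro S _ S' _ h
          ext v
          have := Finset.ext_iff.mp h v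
          simp only [Finset.mem_filter, Finset.mem_univ, true_and] at this
          rw [Bool.eq_iff_iff]
          exact this
    _ = 2 ^ W.card := Finset.card_powerset _
    _ ≤ _ := Nat.pow_le_pow_right (by norm_num) hWcard

/-- The energy of `f` along slides starting close to `S`. -/
def localEnergy [NeZero M] (f : OmegaK (torusGraph M d) k → ℝ) (R : ℕ)
    (S : (Fin d → ZMod M) → Bool) : ℝ :=
  ∑ T, ∑ T', if Slide (torusGraph M d) T.1 T'.1 ∧ Close R S T.1 then |f T - f T'| ^ 2 else 0

lemma localEnergy_nonneg [NeZero M] (f : OmegaK (torusGraph M d) k → ℝ) (R : ℕ)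
    (S : (Fin d → ZMod M) → Bool) : 0 ≤ localEnergy f R S :=
  Finset.sum_nonneg fun _ _ => Finset.sum_nonneg fun _ _ => by split_ifs <;> positivity

lemma localBound_localEnergy [NeZero M] (f : OmegaK (torusGraph M d) k → ℝ) (R : ℕ)
    (x₀ : Fin k → Fin d → ZMod M) :
    LocalBound (extendZero f) x₀ R (√(localEnergy f R (cfg x₀))) := by
  intro x i s hx hx' hs hR
  by_cases hs0 : s = 0
  · simp [hs0]
  refine Real.le_sqrt_of_sq_le ?_
  have hslide := slide_cfg_update hx.injective hx'.injective hs hs0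
  have hclose : Close R (cfg x₀) (cfg x) := by
    intro v hv
    obtain ⟨j, rfl⟩ := cfg_eq_true.mp hv
    exact ⟨x j, cfg_eq_true.mpr ⟨j, rfl⟩, hR j⟩
  rw [extendZero, extendZero, dif_pos hx.cfg_mem, dif_pos hx'.cfg_mem]
  set T : OmegaK (torusGraph M d) k := ⟨cfg x, hx.cfg_mem⟩
  set T' : OmegaK (torusGraph M d) k := ⟨_, hx'.cfg_mem⟩
  have hnn : ∀ T T' : OmegaK (torusGraph M d) k,
      0 ≤ if Slide (torusGraph M d) T.1 T'.1 ∧ Close R (cfg x₀) T.1 then |f T - f T'| ^ 2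
        else 0 := fun _ _ => by split_ifs <;> positivity
  calc |f T - f T'| ^ 2
      = if Slide (torusGraph M d) T.1 T'.1 ∧ Close R (cfg x₀) T.1 then |f T - f T'| ^ 2
        else 0 := (if_pos ⟨hslide, hclose⟩).symm
    _ ≤ ∑ T', if Slide (torusGraph M d) T.1 T'.1 ∧ Close R (cfg x₀) T.1 then |f T - f T'| ^ 2
        else 0 := Finset.single_le_sum (f := fun T' =>
          if Slide (torusGraph M d) T.1 T'.1 ∧ Close R (cfg x₀) T.1 then |f T - f T'| ^ 2
          else 0) (fun T' _ => hnn T T') (Finset.mem_univ T')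
    _ ≤ _ := Finset.single_le_sum (f := fun T => ∑ T',
          if Slide (torusGraph M d) T.1 T'.1 ∧ Close R (cfg x₀) T.1 then |f T - f T'| ^ 2
          else 0) (fun T _ => Finset.sum_nonneg fun T' _ => hnn T T') (Finset.mem_univ T)

/-- The energy of `f` along all slides within `Ω_k`. -/
def slideEnergy [NeZero M] (f : OmegaK (torusGraph M d) k → ℝ) : ℝ :=
  ∑ T, ∑ T', if Slide (torusGraph M d) T.1 T'.1 then |f T - f T'| ^ 2 else 0

lemma sum_localEnergy_le [NeZero M] (f : OmegaK (torusGraph M d) k → ℝ) (R : ℕ) :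
    ∑ S : {z : (Fin d → ZMod M) → Bool // numParticles z = k}, localEnergy f R S.1 ≤
      2 ^ (k * (2 * d + 1) ^ R) * slideEnergy f := by
  unfold localEnergy slideEnergy
  rw [Finset.sum_comm, Finset.mul_sum]
  refine Finset.sum_le_sum fun T _ => ?_
  rw [Finset.sum_comm, Finset.mul_sum]
  refine Finset.sum_le_sum fun T' _ => ?_
  by_cases h : Slide (torusGraph M d) T.1 T'.1
  · simp only [h, true_and, if_true]
    rw [← Finset.sum_filter, Finset.sum_const, nsmul_eq_mul]
    exact mul_le_mul_of_nonneg_right (by exact_mod_cast card_close_le R T.2.1) (by positivity)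
  · simp [h]

end Extension

lemma numParticles_cast_eq_sum {V : Type*} [Fintype V] (S : V → Bool) :
    (numParticles S : ℝ) = ∑ v, if S v = true then (1 : ℝ) else 0 := by
  simp [numParticles]

/-- The number of edges with exactly one occupied endpoint is controlled by the degrees. -/
lemma sum_adj_ne_le {V : Type*} [Fintype V] (G : SimpleGraph V) {Δ : ℕ}
    (hΔ : ∀ u, (Finset.univ.filter fun v => G.Adj u v).card ≤ Δ) (S : V → Bool) :
    (∑ u, ∑ v, if G.Adj u v ∧ S u ≠ S v then (1 : ℝ) else 0) ≤ 2 * numParticles S * Δ := by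
  have h1 : (∑ u, ∑ v, if G.Adj u v ∧ S u = true then (1 : ℝ) else 0) ≤ numParticles S * Δ := by
    rw [numParticles_cast_eq_sum, Finset.sum_mul]
    refine Finset.sum_le_sum fun u _ => ?_
    by_cases hu : S u = true
    · simp only [hu, and_true, if_true, one_mul]
      rw [Finset.sum_boole]
      exact_mod_cast hΔ u
    · simp [hu]
  have h2 : (∑ u, ∑ v, if G.Adj u v ∧ S v = true then (1 : ℝ) else 0) ≤ numParticles S * Δ := by
    rw [Finset.sum_comm]
    simpa only [G.adj_comm] using h1
  calc (∑ u, ∑ v, if G.Adj u v ∧ S u ≠ S v then (1 : ℝ) else 0)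
      ≤ ∑ u, ∑ v, ((if G.Adj u v ∧ S u = true then (1 : ℝ) else 0) +
          if G.Adj u v ∧ S v = true then (1 : ℝ) else 0) := by
        refine Finset.sum_le_sum fun u _ => Finset.sum_le_sum fun v _ => ?_
        by_cases h : G.Adj u v <;> cases hu : S u <;> cases hv : S v <;> simp [h]
    _ ≤ _ := by
        simp only [Finset.sum_add_distrib]
        linarith

lemma card_le_sum_adj {V : Type*} [Fintype V] (G : SimpleGraph V) (hG : ∀ u, ∃ v, G.Adj u v) :
    (Fintype.card V : ℝ) ≤ ∑ u, ∑ v, if G.Adj u v then (1 : ℝ) else 0 := by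
  have : (Fintype.card V : ℝ) = ∑ _u : V, (1 : ℝ) := by simp
  rw [this]
  refine Finset.sum_le_sum fun u _ => ?_
  obtain ⟨v, hv⟩ := hG u
  refine le_trans ?_ (Finset.single_le_sum (f := fun v => if G.Adj u v then (1 : ℝ) else 0)
    (fun v _ => by split_ifs <;> norm_num) (Finset.mem_univ v))
  simp [hv]

lemma seKernel_nonneg {V : Type*} [Fintype V] [DecidableEq V] (G : SimpleGraph V) (k : ℕ)
    (x y : {z : V → Bool // numParticles z = k}) : 0 ≤ seKernel G k x y :=
  div_nonneg
    (Finset.sum_nonneg fun _ _ => Finset.sum_nonneg fun _ _ => by split_ifs <;> norm_num)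
    (Finset.sum_nonneg fun _ _ => Finset.sum_nonneg fun _ _ => by split_ifs <;> norm_num)

/-- The exclusion energy at `S` is controlled by the variation of `g` along slides from `S`. -/
lemma sum_seKernel_le {V : Type*} [Fintype V] [DecidableEq V] (G : SimpleGraph V) {Δ : ℕ}
    (hG : ∀ u, ∃ v, G.Adj u v) (hΔ : ∀ u, (Finset.univ.filter fun v => G.Adj u v).card ≤ Δ)
    {k : ℕ} (S : {z : V → Bool // numParticles z = k}) (g : {z : V → Bool // numParticles z = k} → ℝ)
    {β : ℝ} (hβ : ∀ S', Slide G S.1 S'.1 → |g S - g S'| ^ 2 ≤ β) (hβ0 : 0 ≤ β) :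
    ∑ S', |g S - g S'| ^ 2 * seKernel G k S S' ≤ 2 * k * Δ / Fintype.card V * β := by
  rename_i _ inst
  obtain rfl : inst = fun a b => Classical.propDecidable (a = b) := Subsingleton.elim _ _
  set Z := ∑ u : V, ∑ v : V, if G.Adj u v then (1 : ℝ) else 0 with hZ
  have hcardZ : (Fintype.card V : ℝ) ≤ Z := card_le_sum_adj G hG
  have hterm : ∀ (S' : {z : V → Bool // numParticles z = k}) (u v : V),
      |g S - g S'| ^ 2 * (if G.Adj u v ∧ S'.1 =
        Function.update (Function.update S.1 u (S.1 v)) v (S.1 u) then (1 : ℝ) else 0) ≤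
      if S'.1 = Function.update (Function.update S.1 u (S.1 v)) v (S.1 u) then
        β * (if G.Adj u v ∧ S.1 u ≠ S.1 v then 1 else 0) else 0 := by
    intro S' u v
    by_cases hS' : S'.1 = Function.update (Function.update S.1 u (S.1 v)) v (S.1 u)
    swap
    · simp [hS']
    by_cases hadj : G.Adj u v
    swap
    · simp [hadj]
    rw [if_pos hS', if_pos ⟨hadj, hS'⟩, mul_one]
    by_cases hne : S.1 u = S.1 v
    · have : S' = S := by
        apply Subtype.ext
        rw [hS', hne]
        simp [← hne]
      simp [this, hne]
    rw [if_pos ⟨hadj, hne⟩, mul_one]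
    apply hβ
    cases hu : S.1 u
    · have hv : S.1 v = true := by
        cases hv : S.1 v
        · exact absurd (hu.trans hv.symm) hne
        · rfl
      rw [hu, hv] at hS'
      exact ⟨v, u, hadj.symm, hv, hu, hS'⟩
    · have hv : S.1 v = false := by
        cases hv : S.1 v
        · rfl
        · exact absurd (hu.trans hv.symm) hne
      rw [hu, hv] at hS'
      exact ⟨u, v, hadj, hu, hv, by rw [hS', Function.update_comm hadj.ne]⟩
  have hnum : ∑ S' : {z : V → Bool // numParticles z = k}, |g S - g S'| ^ 2 *
      (∑ u, ∑ v, if G.Adj u v ∧ S'.1 =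
        Function.update (Function.update S.1 u (S.1 v)) v (S.1 u) then (1 : ℝ) else 0) ≤
      2 * k * Δ * β := by
    calc _ = ∑ u, ∑ v, ∑ S' : {z : V → Bool // numParticles z = k}, |g S - g S'| ^ 2 *
          (if G.Adj u v ∧ S'.1 =
            Function.update (Function.update S.1 u (S.1 v)) v (S.1 u) then (1 : ℝ) else 0) := by
          simp only [Finset.mul_sum]
          rw [Finset.sum_comm]
          exact Finset.sum_congr rfl fun u _ => Finset.sum_comm
      _ ≤ ∑ u, ∑ v, β * (if G.Adj u v ∧ S.1 u ≠ S.1 v then 1 else 0) := by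
          refine Finset.sum_le_sum fun u _ => Finset.sum_le_sum fun v _ => ?_
          refine (Finset.sum_le_sum fun S' _ => hterm S' u v).trans ?_
          have hnn : 0 ≤ β * (if G.Adj u v ∧ S.1 u ≠ S.1 v then (1 : ℝ) else 0) :=
            mul_nonneg hβ0 (by split_ifs <;> norm_num)
          rw [← Finset.sum_filter, Finset.sum_const, nsmul_eq_mul]
          refine mul_le_of_le_one_left hnn ?_
          rw [Nat.cast_le_one, Finset.card_le_one]
          intro A hA B hB
          exact Subtype.ext ((Finset.mem_filter.mp hA).2.trans (Finset.mem_filter.mp hB).2.symm)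
      _ = β * ∑ u, ∑ v, (if G.Adj u v ∧ S.1 u ≠ S.1 v then 1 else 0) := by
          simp only [Finset.mul_sum]
      _ ≤ β * (2 * numParticles S.1 * Δ) :=
          mul_le_mul_of_nonneg_left (sum_adj_ne_le G hΔ S.1) hβ0
      _ = _ := by rw [S.2]; ring
  have hsum : ∑ S', |g S - g S'| ^ 2 * seKernel G k S S' =
      (∑ S' : {z : V → Bool // numParticles z = k}, |g S - g S'| ^ 2 *
      (∑ u, ∑ v, if G.Adj u v ∧ S'.1 =
        Function.update (Function.update S.1 u (S.1 v)) v (S.1 u) then (1 : ℝ) else 0)) / Z := by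
    rw [Finset.sum_div]
    refine Finset.sum_congr rfl fun S' _ => ?_
    rw [seKernel, seKernelFull, mul_div_assoc]
  rw [hsum]
  rcases isEmpty_or_nonempty V with hV | hV
  · simp [hZ]
  have hcard : (0 : ℝ) < Fintype.card V := by exact_mod_cast Fintype.card_pos
  rw [div_mul_eq_mul_div]
  exact div_le_div₀ (by positivity) hnum hcard hcardZ

section Comparison

variable {M d k : ℕ}

/-- The constant relating the exclusion energy to the energy along slides. -/
def comparisonConst (d k : ℕ) : ℝ :=
  2 * k * (2 * d + 1 : ℕ) * ((pathLength k : ℝ) ^ 2 * 2 ^ (k * (2 * d + 1) ^ pathRadius k))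

lemma comparisonConst_pos (d : ℕ) (hk : 0 < k) : 0 < comparisonConst d k := by
  have : 0 < pathLength k := by
    unfold pathLength
    positivity
  unfold comparisonConst
  positivity

lemma exists_adj_torusGraph (hM : 1 < M) (a : Fin d) (u : Fin d → ZMod M) :
    ∃ v, (torusGraph M d).Adj u v := by
  have : Fact (1 < M) := ⟨hM⟩
  refine ⟨u + Pi.single a 1, torusGraph_adj.mpr ⟨by simp, ?_⟩⟩
  rw [add_sub_cancel_left]
  exact mem_stepSet.mpr (Or.inr ⟨a, Finset.mem_univ _, Or.inl rfl⟩)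

lemma exists_extension_sum_seKernel_le [NeZero M] {a b : Fin d} (hab : a ≠ b)
    (hM : k * (2 * k + 2) < M) (hk : 0 < k) (f : OmegaK (torusGraph M d) k → ℝ) :
    ∃ g : {z : (Fin d → ZMod M) → Bool // numParticles z = k} → ℝ,
      (∀ S : OmegaK (torusGraph M d) k, g ⟨S.1, S.2.1⟩ = f S) ∧
      ∑ S, ∑ S', |g S - g S'| ^ 2 * seKernel (torusGraph M d) k S S' ≤
        comparisonConst d k / Fintype.card (Fin d → ZMod M) * slideEnergy f := by
  obtain ⟨g, hgf, hg⟩ := exists_extension (k := k) a hM hk f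
  have hM1 : 1 < M := lt_of_le_of_lt (Nat.mul_pos hk (by omega)) hM
  refine ⟨fun S => g S.1, hgf, ?_⟩
  have hS : ∀ S : {z : (Fin d → ZMod M) → Bool // numParticles z = k},
      ∑ S', |g S.1 - g S'.1| ^ 2 * seKernel (torusGraph M d) k S S' ≤
        2 * k * (2 * d + 1 : ℕ) / Fintype.card (Fin d → ZMod M) *
          ((pathLength k : ℝ) ^ 2 * localEnergy f (pathRadius k) S.1) := by
    intro S
    have hE := localEnergy_nonneg f (pathRadius k) S.1
    refine sum_seKernel_le (torusGraph M d) (exists_adj_torusGraph hM1 a)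
      card_torusGraph_neighbors_le S (fun S => g S.1) ?_ (by positivity)
    rintro S' ⟨u, w, hadj, hu, hw, hS'⟩
    obtain ⟨x, hx, hxS⟩ := exists_cfg_eq S.2
    rw [← hxS] at hu hw hS' ⊢
    obtain ⟨i, rfl⟩ := cfg_eq_true.mp hu
    have hw' : ∀ j, x j ≠ w := by
      intro j hj
      rw [cfg_eq_true.mpr ⟨j, hj⟩] at hw
      exact absurd hw (by simp)
    have hx' : Function.Injective (Function.update x i w) := by
      intro j l hjl
      by_cases hj : j = i <;> by_cases hl : l = i
      · rw [hj, hl]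
      · subst hj
        rw [Function.update_self, Function.update_of_ne hl] at hjl
        exact absurd hjl.symm (hw' l)
      · subst hl
        rw [Function.update_self, Function.update_of_ne hj] at hjl
        exact absurd hjl (hw' j)
      · rw [Function.update_of_ne hj, Function.update_of_ne hl] at hjl
        exact hx hjl
    have hstep : ∀ j, Function.update x i w j - x j ∈ stepSet M Finset.univ := by
      intro j
      by_cases hj : j = i
      · subst hj
        rw [Function.update_self]
        exact (torusGraph_adj.mp hadj).2
      · rw [Function.update_of_ne hj, sub_self]
        exact zero_mem_stepSet _
    have h := abs_extension_sub_le hab hM hk hg hx hx' hstep (Real.sqrt_nonneg _)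
      (localBound_localEnergy f (pathRadius k) x)
    rw [cfg_update hx i hw, ← hS'] at h
    have h2 := pow_le_pow_left₀ (abs_nonneg _) h 2
    rwa [mul_pow, Real.sq_sqrt (localEnergy_nonneg f _ _)] at h2
  refine (Finset.sum_le_sum fun S _ => hS S).trans ?_
  rw [← Finset.mul_sum, ← Finset.mul_sum]
  have h3 := sum_localEnergy_le f (pathRadius k)
  calc _ ≤ 2 * k * (2 * d + 1 : ℕ) / (Fintype.card (Fin d → ZMod M) : ℝ) *
        ((pathLength k : ℝ) ^ 2 * (2 ^ (k * (2 * d + 1) ^ pathRadius k) * slideEnergy f)) := by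
        gcongr
    _ = _ := by unfold comparisonConst; ring

lemma slideEnergy_le_sum_traceKernel [NeZero M] {p : ℝ} (hp0 : 0 ≤ p) (hp1 : p ≤ 1 / 2)
    (f : OmegaK (torusGraph M d) k → ℝ) :
    p / Fintype.card (Fin d → ZMod M) * (1 / (2 * ((k + 1) * (2 * d + 1 : ℕ)))) * slideEnergy f ≤
      ∑ T, ∑ T', |f T - f T'| ^ 2 * traceKernel (torusGraph M d) p k T T' := by
  unfold slideEnergy
  simp only [Finset.mul_sum]
  refine Finset.sum_le_sum fun T _ => Finset.sum_le_sum fun T' _ => ?_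
  split_ifs with h
  · obtain ⟨u, w, hadj, hu, hw, hT'⟩ := h
    rw [mul_comm]
    refine mul_le_mul_of_nonneg_left ?_ (by positivity)
    exact le_traceKernel_slide (torusGraph M d) hp0 hp1 k (Nat.succ_pos _)
      card_torusGraph_neighbors_le T T' hadj hu hw hT'
  · rw [mul_zero]
    exact mul_nonneg (by positivity)
      (traceKernel_nonneg _ hp0 (hp1.trans (by norm_num)) k T T')

lemma nontrivial_OmegaK_torusGraph [NeZero M] {a b : Fin d} (hab : a ≠ b)
    (hM : k * (2 * k + 2) < M) (hk : 0 < k) : Nontrivial (OmegaK (torusGraph M d) k) := by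
  have hM1 : 1 < M := lt_of_le_of_lt (Nat.mul_pos hk (by omega)) hM
  have : Fact (1 < M) := ⟨hM1⟩
  obtain ⟨m, -, hsep, -⟩ := exists_stretch (k := k) a (x := fun _ => 0) hM hk
  set y : Fin k → Fin d → ZMod M := fun i => 0 + m i • Pi.single a (1 : ZMod M)
  set i₀ : Fin k := ⟨0, hk⟩
  have hsep' : SepCoord a (Function.update y i₀ (y i₀ + Pi.single b 1)) := by
    refine hsep.congr fun i => ?_
    by_cases hi : i = i₀
    · subst hi; simp [hab]
    · rw [Function.update_of_ne hi]
  refine ⟨⟨cfg y, hsep.good.cfg_mem⟩, ⟨_, hsep'.good.cfg_mem⟩, fun h => ?_⟩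
  have h1 : cfg (Function.update y i₀ (y i₀ + Pi.single b 1)) (y i₀) = true := by
    have h' : cfg y = cfg (Function.update y i₀ (y i₀ + Pi.single b 1)) := congrArg Subtype.val h
    rw [← h']
    exact cfg_eq_true.mpr ⟨i₀, rfl⟩
  obtain ⟨j, hj⟩ := cfg_eq_true.mp h1
  by_cases hji : j = i₀
  · subst hji; simp at hj
  · rw [Function.update_of_ne hji] at hj
    exact hji (hsep.good.injective hj)

end Comparison

end Torus

/-- Fix `0 < c`, `d ≥ 3`, `k ≥ 1`. There exist `N` and `C > 0` (depending
only on `c, k, d`) such that for all `n = (L+1)^d > N`, the log-Sobolev constant `α_{n,k}` of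
the trace chain `Q_{n,k}` of the KCIP on `Ω_k` satisfies `α_{n,k} ≥ C (1/n) α^SE_{n,k}`,
where `α^SE_{n,k}` is the log-Sobolev constant of the simple exclusion process on `Λ(L+1,d)`
with `k` particles. -/
theorem kcip_trace_log_sobolev_comparison (c : ℝ) (hc : 0 < c) (d : ℕ) (hd : 3 ≤ d)
    (k : ℕ) (hk : 1 ≤ k) :
    ∃ N : ℕ, ∃ C : ℝ, 0 < C ∧ ∀ L : ℕ, N < (L + 1) ^ d →
      logSobolevConst
          (traceKernel (torusGraph (L + 1) d) (c / (((L + 1) ^ d : ℕ) : ℝ)) k)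
          (unifDist (OmegaK (torusGraph (L + 1) d) k)) ≥
        C * (1 / (((L + 1) ^ d : ℕ) : ℝ)) *
          logSobolevConst (seKernel (torusGraph (L + 1) d) k)
            (unifDist {z : (Fin d → ZMod (L + 1)) → Bool // numParticles z = k}) := by
  have hd0 : 0 < d := by omega
  have hK := comparisonConst_pos d hk
  refine ⟨max ((k * (2 * k + 2)) ^ d) ⌈2 * c⌉₊,
    c * (1 / (2 * ((k + 1) * (2 * d + 1 : ℕ)))) / comparisonConst d k, by positivity,
    fun L hL => ?_⟩
  have hM : k * (2 * k + 2) < L + 1 :=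
    lt_of_pow_lt_pow_left₀ d (Nat.zero_le _) (lt_of_le_of_lt (le_max_left _ _) hL)
  have hcard : Fintype.card (Fin d → ZMod (L + 1)) = (L + 1) ^ d := by simp
  set n : ℝ := (((L + 1) ^ d : ℕ) : ℝ) with hn
  have hn2c : 2 * c < n :=
    lt_of_le_of_lt (Nat.le_ceil _) (Nat.cast_lt.mpr (lt_of_le_of_lt (le_max_right _ _) hL))
  have hn0 : 0 < n := by linarith
  have hp0 : 0 ≤ c / n := by positivity
  have hp1 : c / n ≤ 1 / 2 := by rw [div_le_iff₀ hn0]; linarith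
  have hab : (⟨0, by omega⟩ : Fin d) ≠ ⟨1, by omega⟩ := by simp
  have := nontrivial_OmegaK_torusGraph (k := k) hab hM hk
  refine logSobolevConst_comparison
    (⟨fun S => ⟨S.1, S.2.1⟩, fun S T h => Subtype.ext (Subtype.mk.inj h)⟩ :
      OmegaK (torusGraph (L + 1) d) k ↪
        {z : (Fin d → ZMod (L + 1)) → Bool // numParticles z = k})
    (seKernel_nonneg _ k) (by positivity) fun f => ?_
  obtain ⟨g, hgf, hg⟩ := exists_extension_sum_seKernel_le hab hM hk f
  refine ⟨g, hgf, ?_⟩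
  have htrace := slideEnergy_le_sum_traceKernel hp0 hp1 f
  rw [hcard, ← hn] at hg htrace
  refine (mul_le_mul_of_nonneg_left hg (by positivity)).trans (le_of_eq_of_le ?_ htrace)
  field_simp
end
end

section
/- For every subgraph H of the torus Λ(L,d), the corrected component count satisfies N_H ≥ |V(H)|/(2d+1). -/
open scoped Classical
open Finset

noncomputable section

/-- The corrected component count `N_H` of the subgraph of `G` induced by the vertex set `H`:
if `H` spans no edge of `G` then `N_H = |H|`; otherwise, with `W(H)` the set of vertices of
`H` having at least one neighbour in `H`, `N_H = |W(H)|⁻¹ Σ_{v ∈ W(H)} N_{H∖{v}}`.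
Equivalently, it is the expected number of vertices remaining when one repeatedly deletes a
uniformly chosen vertex having at least one neighbour, until no edges remain. -/
def correctedCount {V : Type*} [DecidableEq V] (G : SimpleGraph V) (H : Finset V) : ℝ :=
  if (H.filter fun v => ∃ u ∈ H, G.Adj u v).Nonempty then
    (((H.filter fun v => ∃ u ∈ H, G.Adj u v).card : ℝ))⁻¹ *
      ∑ v ∈ (H.filter fun v => ∃ u ∈ H, G.Adj u v).attach,
        correctedCount G (H.erase v.val)
  else (H.card : ℝ)
termination_by H.card
decreasing_by
  exact Finset.card_erase_lt_of_mem (Finset.mem_of_mem_filter _ v.2)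

/-- The number of neighbours of `v` lying in the vertex set `H`. -/
def degreeIn {V : Type*} (G : SimpleGraph V) (H : Finset V) (v : V) : ℕ :=
  (H.filter fun u => G.Adj v u).card

/-- The Caro–Wei sum `Σ_{v ∈ H} 1 / (deg_H(v) + 1)`. -/
def caroWeiSum {V : Type*} (G : SimpleGraph V) (H : Finset V) : ℝ :=
  ∑ v ∈ H, ((degreeIn G H v : ℝ) + 1)⁻¹

lemma degreeIn_pos_iff {V : Type*} (G : SimpleGraph V) (H : Finset V) (v : V) :
    0 < degreeIn G H v ↔ ∃ u ∈ H, G.Adj u v := by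
  simp [degreeIn, Finset.card_pos, Finset.Nonempty, G.adj_comm]

lemma degreeIn_erase_add {V : Type*} [DecidableEq V] (G : SimpleGraph V) {H : Finset V} {v : V}
    (hv : v ∈ H) (u : V) :
    degreeIn G (H.erase v) u + (if G.Adj u v then 1 else 0) = degreeIn G H u := by
  unfold degreeIn
  rw [Finset.filter_erase]
  split_ifs with h
  · exact Finset.card_erase_add_one (by simp [hv, h])
  · rw [Finset.erase_eq_of_notMem (by simp [h]), add_zero]

lemma inv_degreeIn_erase_add_one {V : Type*} [DecidableEq V] (G : SimpleGraph V) {H : Finset V}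
    {v : V} (hv : v ∈ H) (u : V) :
    ((degreeIn G (H.erase v) u : ℝ) + 1)⁻¹ = ((degreeIn G H u : ℝ) + 1)⁻¹ +
      if G.Adj u v then ((degreeIn G H u : ℝ) * (degreeIn G H u + 1))⁻¹ else 0 := by
  have h := degreeIn_erase_add G hv u
  rw [← h]
  split_ifs with ha
  · push_cast
    have h1 : (degreeIn G (H.erase v) u : ℝ) + 1 ≠ 0 := by positivity
    have h2 : (degreeIn G (H.erase v) u : ℝ) + 1 + 1 ≠ 0 := by positivity
    field_simp
  · simp

lemma caroWeiSum_erase {V : Type*} [DecidableEq V] (G : SimpleGraph V) {H : Finset V} {v : V}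
    (hv : v ∈ H) :
    caroWeiSum G (H.erase v) = caroWeiSum G H - ((degreeIn G H v : ℝ) + 1)⁻¹ +
      ∑ u ∈ H, if G.Adj u v then ((degreeIn G H u : ℝ) * (degreeIn G H u + 1))⁻¹ else 0 := by
  unfold caroWeiSum
  rw [Finset.sum_congr rfl fun u _ => inv_degreeIn_erase_add_one G hv u, Finset.sum_add_distrib,
    ← Finset.sum_erase_add H _ hv,
    Finset.sum_erase (f := fun u => if G.Adj u v then
      ((degreeIn G H u : ℝ) * (degreeIn G H u + 1))⁻¹ else 0) H (a := v) (by simp)]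
  ring

/-- The Caro–Wei sum is preserved on average when a uniformly chosen non-isolated vertex is
deleted. -/
lemma sum_caroWeiSum_erase {V : Type*} [DecidableEq V] (G : SimpleGraph V) (H : Finset V) :
    ∑ v ∈ H.filter (fun v => ∃ u ∈ H, G.Adj u v), caroWeiSum G (H.erase v) =
      (H.filter fun v => ∃ u ∈ H, G.Adj u v).card * caroWeiSum G H := by
  rw [Finset.sum_congr rfl fun v hv => caroWeiSum_erase G (Finset.mem_of_mem_filter v hv),
    Finset.sum_add_distrib, Finset.sum_sub_distrib, Finset.sum_const, nsmul_eq_mul]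
  have key : ∑ v ∈ H.filter (fun v => ∃ u ∈ H, G.Adj u v), ∑ u ∈ H,
      (if G.Adj u v then ((degreeIn G H u : ℝ) * (degreeIn G H u + 1))⁻¹ else 0) =
      ∑ v ∈ H.filter (fun v => ∃ u ∈ H, G.Adj u v), ((degreeIn G H v : ℝ) + 1)⁻¹ := by
    rw [Finset.sum_comm, Finset.sum_filter]
    refine Finset.sum_congr rfl fun u hu => ?_
    have hfilter : (H.filter fun v => ∃ u ∈ H, G.Adj u v).filter (fun v => G.Adj u v) =
        H.filter fun v => G.Adj u v := by
      ext v
      simp only [Finset.mem_filter]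
      exact ⟨fun h => ⟨h.1.1, h.2⟩, fun h => ⟨⟨h.1, u, hu, h.2⟩, h.2⟩⟩
    rw [← Finset.sum_filter, hfilter, Finset.sum_const, nsmul_eq_mul]
    change (degreeIn G H u : ℝ) * _ = _
    split_ifs with h
    · have hpos : (0 : ℝ) < degreeIn G H u := by
        exact_mod_cast (degreeIn_pos_iff G H u).2 h
      field_simp
    · have hzero : degreeIn G H u = 0 :=
        Nat.eq_zero_of_not_pos (mt (degreeIn_pos_iff G H u).1 h)
      simp [hzero]
  rw [key]
  ring

/-- The corrected component count equals the Caro–Wei sum. -/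
theorem correctedCount_eq_caroWeiSum {V : Type*} [DecidableEq V] (G : SimpleGraph V)
    (H : Finset V) : correctedCount G H = caroWeiSum G H := by
  induction H using Finset.strongInduction with
  | H H ih =>
    rw [correctedCount]
    split_ifs with hW
    · rw [Finset.sum_attach _ fun v => correctedCount G (H.erase v),
        Finset.sum_congr rfl fun v hv =>
          ih _ (Finset.erase_ssubset (Finset.mem_of_mem_filter v hv)),
        sum_caroWeiSum_erase, inv_mul_cancel_left₀]
      exact_mod_cast hW.card_pos.ne'
    · have hdeg : ∀ v ∈ H, degreeIn G H v = 0 := fun v hv =>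
        Nat.eq_zero_of_not_pos fun h =>
          hW ⟨v, Finset.mem_filter.2 ⟨hv, (degreeIn_pos_iff G H v).1 h⟩⟩
      unfold caroWeiSum
      rw [Finset.sum_congr rfl fun v hv => by rw [hdeg v hv]]
      simp

lemma degreeIn_torusGraph_le (L d : ℕ) (H : Finset (Fin d → ZMod L)) (v : Fin d → ZMod L) :
    degreeIn (torusGraph L d) H v ≤ 2 * d := by
  let e : Fin d → Fin d → ZMod L := fun i j => if j = i then 1 else 0
  have hsub : (H.filter fun u => (torusGraph L d).Adj v u) ⊆
      Finset.univ.image (fun i => v + e i) ∪ Finset.univ.image (fun i => v - e i) := by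
    intro u hu
    have hadj := (Finset.mem_filter.1 hu).2
    rw [torusGraph, SimpleGraph.fromRel_adj] at hadj
    rw [Finset.mem_union, Finset.mem_image, Finset.mem_image]
    rcases hadj.2 with ⟨i, hi⟩ | ⟨i, hi⟩
    · exact Or.inl ⟨i, Finset.mem_univ i, hi.symm⟩
    · exact Or.inr ⟨i, Finset.mem_univ i, sub_eq_of_eq_add hi⟩
  calc degreeIn (torusGraph L d) H v
      ≤ (Finset.univ.image (fun i => v + e i) ∪ Finset.univ.image (fun i => v - e i)).card :=
        Finset.card_le_card hsub
    _ ≤ (Finset.univ.image fun i => v + e i).card + (Finset.univ.image fun i => v - e i).card :=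
        Finset.card_union_le _ _
    _ ≤ d + d := by
        gcongr <;> exact Finset.card_image_le.trans (by simp)
    _ = 2 * d := by ring

/-- For every subgraph `H` of the torus `Λ(L,d)` (given by its vertex set),
the corrected component count satisfies `N_H ≥ |V(H)|/(2d+1)`. -/
theorem correctedCount_torus_lower_bound (L d : ℕ) (H : Finset (Fin d → ZMod (L + 1))) :
    correctedCount (torusGraph (L + 1) d) H ≥ (H.card : ℝ) / (2 * (d : ℝ) + 1) := by
  rw [ge_iff_le, correctedCount_eq_caroWeiSum, caroWeiSum, div_eq_mul_inv, ← nsmul_eq_mul]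
  refine Finset.card_nsmul_le_sum _ _ _ fun v _ => ?_
  have hdeg : (degreeIn (torusGraph (L + 1) d) H v : ℝ) ≤ 2 * d := by
    exact_mod_cast degreeIn_torusGraph_le (L + 1) d H v
  gcongr
end
end

section
/- Let H(k) denote the star graph with k leaves (one center vertex adjacent to each of k leaves, and no other edges). Then for every integer k≥1, the corrected component count satisfies N_{H(k)} = k/2 + 1/(k+1). -/
open scoped Classical
open Finset

noncomputable section

/-- The star graph with `k` leaves: the center `Fin.last k` is adjacent to each of the `k`
leaves `0, …, k-1`, and there are no other edges. -/
def starGraph (k : ℕ) : SimpleGraph (Fin (k + 1)) :=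
  SimpleGraph.fromRel fun u _ => u = Fin.last k

theorem correctedCount_of_not_adj {V : Type*} [DecidableEq V] {G : SimpleGraph V}
    {H : Finset V} (h : ∀ u ∈ H, ∀ v ∈ H, ¬ G.Adj u v) : correctedCount G H = H.card := by
  rw [correctedCount, if_neg]
  rintro ⟨v, hv⟩
  obtain ⟨hv, u, hu, huv⟩ := Finset.mem_filter.1 hv
  exact h u hu v hv huv

theorem correctedCount_of_forall_exists_adj {V : Type*} [DecidableEq V] {G : SimpleGraph V}
    {H : Finset V} (hne : H.Nonempty) (h : ∀ v ∈ H, ∃ u ∈ H, G.Adj u v) :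
    correctedCount G H = (H.card : ℝ)⁻¹ * ∑ v ∈ H, correctedCount G (H.erase v) := by
  have hW : (H.filter fun v => ∃ u ∈ H, G.Adj u v) = H := Finset.filter_true_of_mem h
  rw [correctedCount, hW, if_pos hne,
    Finset.sum_attach H fun v => correctedCount G (H.erase v)]

/-- The corrected component count of a set of vertices that spans a star with center `c`. -/
theorem correctedCount_of_star {V : Type*} [DecidableEq V] {G : SimpleGraph V} {c : V}
    (hG : ∀ u v, G.Adj u v ↔ u ≠ v ∧ (u = c ∨ v = c)) (m : ℕ) :
    ∀ H : Finset V, c ∈ H → H.card = m + 1 →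
      correctedCount G H = (m : ℝ) / 2 + 1 / ((m : ℝ) + 1) := by
  induction m with
  | zero =>
    intro H _ hcard
    obtain ⟨a, rfl⟩ := Finset.card_eq_one.1 hcard
    rw [correctedCount_of_not_adj (by simp)]
    simp
  | succ m ih =>
    intro H hc hcard
    have hcover : ∀ v ∈ H, ∃ u ∈ H, G.Adj u v := by
      intro v hv
      by_cases hvc : v = c
      · obtain ⟨u, hu, huv⟩ := Finset.exists_mem_ne (by omega : 1 < H.card) v
        exact ⟨u, hu, (hG u v).2 ⟨huv, Or.inr hvc⟩⟩
      · exact ⟨c, hc, (hG c v).2 ⟨Ne.symm hvc, Or.inl rfl⟩⟩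
    have hcenter : correctedCount G (H.erase c) = (m : ℝ) + 1 := by
      rw [correctedCount_of_not_adj, Finset.card_erase_of_mem hc, hcard]
      · push_cast [Nat.add_sub_cancel]
        rfl
      · intro u hu v hv huv
        rcases ((hG u v).1 huv).2 with rfl | rfl
        · exact Finset.notMem_erase _ _ hu
        · exact Finset.notMem_erase _ _ hv
    have hleaf : ∀ v ∈ H.erase c,
        correctedCount G (H.erase v) = (m : ℝ) / 2 + 1 / ((m : ℝ) + 1) := by
      intro v hv
      obtain ⟨hvc, hv⟩ := Finset.mem_erase.1 hv
      exact ih _ (Finset.mem_erase.2 ⟨Ne.symm hvc, hc⟩)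
        (by rw [Finset.card_erase_of_mem hv, hcard, Nat.add_sub_cancel])
    rw [correctedCount_of_forall_exists_adj ⟨c, hc⟩ hcover, ← Finset.add_sum_erase H _ hc,
      hcenter, Finset.sum_congr rfl hleaf, Finset.sum_const, Finset.card_erase_of_mem hc, hcard,
      Nat.add_sub_cancel, nsmul_eq_mul]
    push_cast
    have h₁ : (m : ℝ) + 1 ≠ 0 := by positivity
    have h₂ : (m : ℝ) + 1 + 1 ≠ 0 := by positivity
    field_simp
    ring

/-- For every `k ≥ 1`, the corrected component count of the star graph with
`k` leaves satisfies `N_{H(k)} = k/2 + 1/(k+1)`. -/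
theorem correctedCount_starGraph (k : ℕ) (hk : 1 ≤ k) :
    correctedCount (starGraph k) Finset.univ = (k : ℝ) / 2 + 1 / ((k : ℝ) + 1) := by
  exact correctedCount_of_star (c := Fin.last k) (fun u v => by simp [starGraph]) k _
    (Finset.mem_univ _) (by simp)
end
end
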